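/- arXiv:2507.12086 — 2 statements merged into one kernel-verified Lean document; each statement's English description precedes it below -/
import Mathlib

section
/- Let G be a finite simple graph that is 2-connected (G has at least 3 vertices and G − v is connected for every vertex v), claw-free (G has no induced subgraph isomorphic to K_{1,3}), and nontraceable (G has no hamiltonian path). Then G has at least 18 vertices. -/
open SimpleGraph

/-- The detour order of a vertex `v`: the maximum number of vertices of a path
in `G` having `v` as an endvertex. -/
noncomputable def vertexDetourOrder {V : Type*} (G : SimpleGraph V) (v : V) : ℕ :=
  sSup {n | ∃ (w : V) (p : G.Walk v w), p.IsPath ∧ n = p.length + 1}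

/-- The detour order of `G`: the maximum number of vertices of a path in `G`. -/
noncomputable def detourOrder {V : Type*} (G : SimpleGraph V) : ℕ :=
  sSup {n | ∃ (u w : V) (p : G.Walk u w), p.IsPath ∧ n = p.length + 1}

/-- A graph is traceable if it has a hamiltonian path, i.e. a path through all vertices. -/
def Traceable {V : Type*} (G : SimpleGraph V) : Prop :=
  ∃ (u w : V) (p : G.Walk u w), p.IsPath ∧ ∀ x, x ∈ p.support

set_option linter.unusedSimpArgs false
set_option linter.unusedVariables false
/-! ### Part A: hamiltonian cycles in lists, local completion -/

namespace CF

def HC {W : Type*} (R : W → W → Prop) (l : List W) : Prop :=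
  l.IsChain R ∧ ∀ p ∈ l.getLast?, ∀ q ∈ l.head?, R p q

def Good {W : Type*} (R : W → W → Prop) (u v t : W) : Prop :=
  t = u ∨ t = v ∨ R t u ∨ R t v

theorem key_ordered {W : Type*} (R : W → W → Prop) (hs : ∀ a b, R a b → R b a)
    (A B C : List W) (u v a x am xp b2 b1 : W)
    (hAu : A.head? = some u) (hAm : A.getLast? = some am)
    (hCv : C.getLast? = some v) (hCx : C.head? = some xp)
    (hB : B = [] ∨ (B.head? = some b1 ∧ B.getLast? = some b2))
    (hnd : (A ++ a :: (B ++ x :: C)).Nodup) (hch : (A ++ a :: (B ++ x :: C)).IsChain R)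
    (hau : R a u) (hav : R a v) (hxu : R x u) (hxv : R x v) (hax : R a x)
    (hx : ∀ t, R x t → Good R u v t)
    (ha : ∀ t t', R a t → R a t' → t ≠ t' → Good R u v t ∨ R t' t ∨ R t' x ∨ t' = x) :
    ∃ l', l'.Perm (A ++ a :: (B ++ x :: C)) ∧ HC R l' := by
  classical
  have e : (fun a b => R b a) = R := by
    funext a b; exact propext ⟨hs _ _, hs _ _⟩
  have mu : u ∈ A := List.mem_of_mem_head? hAu
  have mam : am ∈ A := List.mem_of_getLast? hAm
  have mv : v ∈ C := List.mem_of_getLast? hCv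
  rcases hB with rfl | ⟨hB1, hB2⟩
  · refine ⟨(A ++ [a]).reverse ++ x :: C, ?_, ?_⟩
    · simpa using ((List.reverse_perm A).append_right (x :: C)).cons a |>.trans
        (List.perm_middle (l₁ := A) (l₂ := x :: C) (a := a)).symm
    · simp [HC, List.isChain_append, List.isChain_cons, List.isChain_reverse, hAu, hAm, hCv, hCx, e,
        List.getLast?_append, List.getLast?_cons] at hch ⊢
      grind
  · have mb1 : b1 ∈ B := List.mem_of_mem_head? hB1
    have mb2 : b2 ∈ B := List.mem_of_getLast? hB2
    have key : ∀ l', (∀ z, l'.count z = (A ++ a :: (B ++ x :: C)).count z) → HC R l' →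
      ∃ l', l'.Perm (A ++ a :: (B ++ x :: C)) ∧ HC R l' := fun l' h1 h2 =>
        ⟨l', List.perm_iff_count.2 h1, h2⟩
    have n1 : b2 ≠ u := by rintro rfl; simp [List.nodup_append] at hnd; grind
    have n2 : b2 ≠ v := by rintro rfl; simp [List.nodup_append] at hnd; grind
    have n3 : b1 ≠ u := by rintro rfl; simp [List.nodup_append] at hnd; grind
    have n4 : b1 ≠ v := by rintro rfl; simp [List.nodup_append] at hnd; grind
    have n5 : am ≠ x := by rintro rfl; simp [List.nodup_append] at hnd; grind
    have n6 : b1 ≠ am := by rintro rfl; simp [List.nodup_append] at hnd; grind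
    simp [List.isChain_append, List.isChain_cons, hAu, hAm, hCv, hCx, hB1, hB2] at hch
    obtain ⟨cA, ⟨ab, cB, ⟨cxp, cC⟩, b2x⟩, ama⟩ := hch
    have g2 : R b2 u ∨ R b2 v := by
      rcases hx b2 (hs _ _ b2x) with h | h | h | h
      · exact absurd h n1
      · exact absurd h n2
      · exact Or.inl h
      · exact Or.inr h
    rcases g2 with g2 | g2
    swap
    · apply key ((A ++ a :: B).reverse ++ x :: C)
      · intro z; simp [List.count_append, List.count_cons]; omega
      · simp [HC, List.isChain_append, List.isChain_cons, List.isChain_reverse, hAu, hAm, hCv, hCx,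
          hB1, hB2, e, List.getLast?_append, List.getLast?_cons]
        grind
    rcases ha b1 am ab (hs _ _ ama) n6 with (h | h | h | h) | h | h | h
    · exact absurd h n3
    · exact absurd h n4
    · apply key ((A ++ [a]).reverse ++ (B ++ x :: C))
      · intro z; simp [List.count_append, List.count_cons]; omega
      · simp [HC, List.isChain_append, List.isChain_cons, List.isChain_reverse, hAu, hAm, hCv, hCx,
          hB1, hB2, e, List.getLast?_append, List.getLast?_cons]
        grind
    · apply key (B.reverse ++ (C.reverse ++ (x :: a :: A.reverse)))
      · intro z; simp [List.count_append, List.count_cons]; omega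
      · simp [HC, List.isChain_append, List.isChain_cons, List.isChain_reverse, hAu, hAm, hCv, hCx,
          hB1, hB2, e, List.getLast?_append, List.getLast?_cons]
        grind
    · apply key (A ++ (B ++ (x :: C ++ [a])))
      · intro z; simp [List.count_append, List.count_cons]; omega
      · simp [HC, List.isChain_append, List.isChain_cons, List.isChain_reverse, hAu, hAm, hCv, hCx,
          hB1, hB2, e, List.getLast?_append, List.getLast?_cons]
        grind
    · apply key (a :: B ++ (A ++ (x :: C)))
      · intro z; simp [List.count_append, List.count_cons]; omega
      · simp [HC, List.isChain_append, List.isChain_cons, List.isChain_reverse, hAu, hAm, hCv, hCx,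
          hB1, hB2, e, List.getLast?_append, List.getLast?_cons]
        grind
    · exact absurd h n5

theorem key_unordered {W : Type*} (R : W → W → Prop) (hs : ∀ a b, R a b → R b a)
    (l : List W) (u v a x : W) (hlu : l.head? = some u) (hlv : l.getLast? = some v)
    (hnd : l.Nodup) (hch : l.IsChain R) (hal : a ∈ l) (hxl : x ∈ l)
    (nau : a ≠ u) (nav : a ≠ v) (nxu : x ≠ u) (nxv : x ≠ v) (nax : a ≠ x)
    (hau : R a u) (hav : R a v) (hxu : R x u) (hxv : R x v) (hax : R a x)
    (hx : ∀ t, R x t → Good R u v t)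
    (ha : ∀ t t', R a t → R a t' → t ≠ t' → Good R u v t ∨ R t' t ∨ R t' x ∨ t' = x) :
    ∃ l', l'.Perm l ∧ HC R l' := by
  have main : ∀ (u v : W) (l : List W), l.head? = some u → l.getLast? = some v → l.Nodup →
      l.IsChain R → a ≠ u → x ≠ v → R a u → R a v → R x u → R x v →
      (∀ t, R x t → Good R u v t) →
      (∀ t t', R a t → R a t' → t ≠ t' → Good R u v t ∨ R t' t ∨ R t' x ∨ t' = x) →
      (∃ A B C, l = A ++ a :: (B ++ x :: C)) → ∃ l', l'.Perm l ∧ HC R l' := by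
    rintro u v l hlu hlv hnd hch nau nxv hau hav hxu hxv hx ha ⟨A, B, C, rfl⟩
    have hA : A ≠ [] := by
      rintro rfl; simp at hlu; exact nau hlu
    have hC : C ≠ [] := by
      rintro rfl; simp [List.getLast?_append, List.getLast?_cons] at hlv; exact nxv hlv
    obtain ⟨am, ham⟩ : ∃ am, A.getLast? = some am := by
      rw [← Option.isSome_iff_exists]; simpa using hA
    obtain ⟨xp, hxp⟩ : ∃ am, C.head? = some am := by
      rw [← Option.isSome_iff_exists]; simpa using hC
    have hAu : A.head? = some u := by
      cases A with
      | nil => simp at hA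
      | cons p A => simpa using hlu
    have hCv : C.getLast? = some v := by
      cases C with
      | nil => simp at hC
      | cons p C => simpa [List.getLast?_append, List.getLast?_cons] using hlv
    rcases eq_or_ne B [] with hB | hB
    · exact key_ordered R hs A B C u v a x am xp u u hAu ham hCv hxp (Or.inl hB) hnd hch
        hau hav hxu hxv hax hx ha
    · obtain ⟨b2, hb2⟩ : ∃ am, B.getLast? = some am := by
        rw [← Option.isSome_iff_exists]; simpa using hB
      obtain ⟨b1, hb1⟩ : ∃ am, B.head? = some am := by
        rw [← Option.isSome_iff_exists]; simpa using hB
      exact key_ordered R hs A B C u v a x am xp b2 b1 hAu ham hCv hxp (Or.inr ⟨hb1, hb2⟩) hnd hch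
        hau hav hxu hxv hax hx ha
  obtain ⟨P, Q, rfl⟩ := List.append_of_mem hal
  rcases List.mem_append.1 hxl with h | h
  · obtain ⟨P1, P2, rfl⟩ := List.append_of_mem h
    have e : (fun a b => R b a) = R := by
      funext a b; exact propext ⟨hs _ _, hs _ _⟩
    obtain ⟨l', h1, h2⟩ := main v u ((P1 ++ x :: P2 ++ a :: Q).reverse) (by rw [List.head?_reverse, hlv])
      (by rw [List.getLast?_reverse, hlu])
      (by rwa [List.nodup_reverse]) (by rwa [List.isChain_reverse, e]) nav nxu hav hau hxv hxu
      (fun t ht => by have := hx t ht; unfold Good at *; tauto)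
      (fun t t' h1 h2 h3 => by have := ha t t' h1 h2 h3; unfold Good at *; tauto)
      ⟨Q.reverse, P2.reverse, P1.reverse, by simp⟩
    exact ⟨l', h1.trans (List.reverse_perm _), h2⟩
  · have hxQ : x ∈ Q := by
      rcases List.mem_cons.1 h with h | h
      · exact absurd h.symm nax
      · exact h
    obtain ⟨P1, P2, rfl⟩ := List.append_of_mem hxQ
    exact main u v _ hlu hlv hnd hch nau nxv hau hav hxu hxv hx ha ⟨P, P1, P2, rfl⟩

end CF

namespace CF

/-! ### traceability through lists, the local completion step -/

def Tr {V : Type*} (G : SimpleGraph V) : Prop :=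
  ∃ l : List V, l.Nodup ∧ (∀ v, v ∈ l) ∧ l.IsChain G.Adj

def ClawFree {V : Type*} (G : SimpleGraph V) : Prop :=
  ∀ v a b c : V, G.Adj v a → G.Adj v b → G.Adj v c →
      a ≠ b → a ≠ c → b ≠ c → G.Adj a b ∨ G.Adj a c ∨ G.Adj b c

/-- cone relation -/
def Cone {V : Type*} (K : SimpleGraph V) : Option V → Option V → Prop
  | none, none => False
  | none, some _ => True
  | some _, none => True
  | some a, some b => K.Adj a b

theorem Cone.symm {V : Type*} (K : SimpleGraph V) : ∀ a b, Cone K a b → Cone K b a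
  | none, none, h => h
  | none, some _, h => trivial
  | some _, none, h => trivial
  | some a, some b, h => SimpleGraph.Adj.symm h

theorem tr_of_cone {V : Type*} (K : SimpleGraph V) (l : List (Option V)) (hnd : l.Nodup)
    (hall : ∀ v, v ∈ l) (h : HC (Cone K) l) : Tr K := by
  obtain ⟨L1, L2, rfl⟩ := List.append_of_mem (hall none)
  have hn : none ∉ L2 ++ L1 := by
    simp [List.nodup_append] at hnd ⊢; grind
  obtain ⟨L, hL⟩ : ∃ L : List V, L.map some = L2 ++ L1 := by
    refine ⟨(L2 ++ L1).reduceOption, ?_⟩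
    generalize L2 ++ L1 = M at hn
    induction M with
    | nil => rfl
    | cons a M ih =>
      cases a with
      | none => simp at hn
      | some a =>
        simp at hn
        simp [ih hn]
  have hp : (L2 ++ L1).Nodup := by
    simp [List.nodup_append] at hnd ⊢; grind
  refine ⟨L, ?_, ?_, ?_⟩
  · rw [← hL] at hp; exact List.Nodup.of_map _ hp
  · intro v
    have := hall (some v)
    have h2 : some v ∈ L2 ++ L1 := by simp at this ⊢; tauto
    rw [← hL] at h2; simpa using h2
  · have hc : (L2 ++ L1).IsChain (Cone K) := by
      obtain ⟨h1, h2⟩ := h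
      rw [List.isChain_append] at h1 ⊢
      rw [List.isChain_cons] at h1
      refine ⟨h1.2.1.2, h1.1, ?_⟩
      intro p hp q hq
      apply h2
      · simp [List.getLast?_append, List.getLast?_cons]
        simp at hp; simp [hp]
      · simp at hq; simp [hq]
    rw [← hL, List.isChain_map] at hc
    exact hc

theorem step {V : Type*} (G K : SimpleGraph V) (hcf : ClawFree G) (x : V) (hGK : G ≤ K)
    (hKG : ∀ a b, K.Adj a b → G.Adj a b ∨ (G.Adj x a ∧ G.Adj x b))
    (u v y : V) (hu : G.Adj x u) (hv : G.Adj x v) (hy : G.Adj x y) (huv : u ≠ v)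
    (hyu : K.Adj y u) (hyv : K.Adj y v)
    (H : Tr (K ⊔ SimpleGraph.edge u v)) : Tr K := by
  classical
  obtain ⟨l, hnd, hall, hch⟩ := H
  by_cases hc : l.IsChain K.Adj
  · exact ⟨l, hnd, hall, hc⟩
  -- find the place where the new edge is used
  have hsplit : ∃ P p q Q, l = P ++ p :: q :: Q ∧ ¬ K.Adj p q := by
    clear hnd hall hch
    induction l with
    | nil => simp at hc
    | cons a l ih =>
      cases l with
      | nil => simp at hc
      | cons b l =>
        by_cases hab : K.Adj a b
        · rw [List.isChain_cons_cons] at hc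
          obtain ⟨P, p, q, Q, h1, h2⟩ := ih (fun h => hc ⟨hab, h⟩)
          exact ⟨a :: P, p, q, Q, by rw [h1]; rfl, h2⟩
        · exact ⟨[], a, b, l, rfl, hab⟩
  obtain ⟨P, p, q, Q, rfl, hpq⟩ := hsplit
  have hpq' : (p = u ∧ q = v) ∨ (p = v ∧ q = u) := by
    simp [List.isChain_append, List.isChain_cons_cons] at hch
    have := hch.2.1.1
    simp [hpq, SimpleGraph.edge_adj] at this
    tauto
  have hP : (P ++ [p]).IsChain K.Adj ∧ (q :: Q).IsChain K.Adj := by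
    have e : P ++ p :: q :: Q = (P ++ [p]) ++ (q :: Q) := by simp
    rw [e, List.isChain_append] at hch
    rw [e, List.nodup_append] at hnd
    refine ⟨hch.1.imp_of_mem_imp ?_, hch.2.1.imp_of_mem_imp ?_⟩
    · intro a b ha hb hab
      have h1 := hnd.2.2 a ha q (by simp)
      have h2 := hnd.2.2 b hb q (by simp)
      simp [SimpleGraph.edge_adj] at hab
      grind
    · intro a b ha hb hab
      have h1 := hnd.2.2 p (by simp) a ha
      have h2 := hnd.2.2 p (by simp) b hb
      simp [SimpleGraph.edge_adj] at hab
      grind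
  have hp : G.Adj x p ∧ G.Adj x q ∧ K.Adj y p ∧ K.Adj y q ∧ p ≠ q := by
    rcases hpq' with ⟨rfl, rfl⟩ | ⟨rfl, rfl⟩ <;> simp_all
    exact fun h => huv h.symm
  clear hpq' hu hv huv hyu hyv hch hc
  obtain ⟨hu, hv, hyu, hyv, huv⟩ := hp
  have eK : (fun a b => K.Adj b a) = K.Adj := by
    funext a b; exact propext ⟨fun h => h.symm, fun h => h.symm⟩
  have eC : (fun a b => Cone K (some a) (some b)) = K.Adj := rfl
  obtain ⟨l', hl', hHC⟩ := key_unordered (Cone K) (Cone.symm K)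
    ((P ++ [p]).reverse.map some ++ none :: (q :: Q).reverse.map some) (some p) (some q)
    (some y) (some x) (by simp) (by simp [List.getLast?_append, List.getLast?_cons])
    (by
      have hinj : Function.Injective (some : V → Option V) := Option.some_injective V
      simp [List.nodup_append] at hnd ⊢
      simp [List.nodup_map_iff hinj, List.nodup_append]
      grind)
    (by
      rw [List.isChain_append, List.isChain_cons, List.isChain_map, List.isChain_map,
        List.isChain_reverse, List.isChain_reverse]
      refine ⟨?_, ⟨?_, ?_⟩, ?_⟩
      · have := hP.1; rw [← eK] at this; exact this
      · intro z hz
        cases z with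
        | none => simp at hz
        | some z => trivial
      · have := hP.2; rw [← eK] at this; exact this
      · intro z hz w hw
        simp at hw; subst hw
        cases z with
        | none => have := List.mem_of_getLast? hz; simp at this
        | some z => trivial)
    (by have := hall y; simp at this ⊢; tauto)
    (by have := hall x; simp at this ⊢; tauto)
    (by simp; exact hyu.ne) (by simp; exact hyv.ne) (by simp; exact hu.ne) (by simp; exact hv.ne)
    (by simp; exact hy.ne.symm) hyu hyv (hGK hu) (hGK hv) (hGK hy.symm)
    (by
      intro t ht
      cases t with
      | none => right; right; left; trivial
      | some t =>
        have ht' : G.Adj x t := by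
          rcases hKG _ _ ht with h | h
          · exact h
          · exact absurd h.1 (G.irrefl)
        by_cases h1 : t = p
        · left; rw [h1]
        by_cases h2 : t = q
        · right; left; rw [h2]
        rcases hcf x t p q ht' hu hv h1 h2 huv with h | h | h
        · right; right; left; exact hGK h
        · right; right; right; exact hGK h
        · exact absurd (hGK h) hpq)
    (by
      intro t t' ht ht' htt
      cases t with
      | none => left; right; right; left; trivial
      | some t =>
      cases t' with
      | none => right; left; trivial
      | some t' =>
        by_cases hxt : G.Adj x t
        · left
          by_cases h1 : t = p
          · left; rw [h1]
          by_cases h2 : t = q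
          · right; left; rw [h2]
          rcases hcf x t p q hxt hu hv h1 h2 huv with h | h | h
          · right; right; left; exact hGK h
          · right; right; right; exact hGK h
          · exact absurd (hGK h) hpq
        by_cases hxt' : G.Adj x t'
        · right; right; left; exact hGK hxt'.symm
        by_cases e1 : t' = x
        · right; right; right; rw [e1]
        by_cases e2 : t = x
        · left; right; right; left; rw [e2]; exact hGK hu
        have a1 : G.Adj y t := by
          rcases hKG _ _ ht with h | h
          · exact h
          · exact absurd h.2 hxt
        have a2 : G.Adj y t' := by
          rcases hKG _ _ ht' with h | h
          · exact h
          · exact absurd h.2 hxt'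
        rcases hcf y x t t' hy.symm a1 a2 (Ne.symm e2) (Ne.symm e1) (fun h => htt (by rw [h])) with h | h | h
        · exact absurd h hxt
        · exact absurd h hxt'
        · right; left; exact hGK h.symm)
  refine tr_of_cone K l' (hl'.nodup_iff.2 ?_) (fun v => hl'.mem_iff.2 ?_) hHC
  · have hinj : Function.Injective (some : V → Option V) := Option.some_injective V
    simp [List.nodup_append] at hnd ⊢
    simp [List.nodup_map_iff hinj, List.nodup_append]
    grind
  · cases v with
    | none => simp
    | some v => have := hall v; simp at this ⊢; tauto

end CF

namespace CF

/-! ### the closure -/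

def comp {V : Type*} (G : SimpleGraph V) (x : V) : SimpleGraph V where
  Adj a b := G.Adj a b ∨ (a ≠ b ∧ G.Adj x a ∧ G.Adj x b)
  symm := ⟨fun a b h => by
    rcases h with h | ⟨h1, h2, h3⟩
    · exact Or.inl h.symm
    · exact Or.inr ⟨h1.symm, h3, h2⟩⟩
  loopless := ⟨fun a h => by
    rcases h with h | ⟨h1, h2, h3⟩
    · exact G.irrefl h
    · exact h1 rfl⟩

theorem comp_adj {V : Type*} (G : SimpleGraph V) (x a b : V) :
    (comp G x).Adj a b ↔ G.Adj a b ∨ (a ≠ b ∧ G.Adj x a ∧ G.Adj x b) := Iff.rfl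

theorem comp_clawFree {V : Type*} (G : SimpleGraph V) (hcf : ClawFree G) (x : V) :
    ClawFree (comp G x) := by
  intro z a b c hza hzb hzc nab nac nbc
  simp only [comp_adj] at *
  by_cases hz : G.Adj x z
  · by_contra hcon
    push Not at hcon
    obtain ⟨⟨h1, h1'⟩, ⟨h2, h2'⟩, ⟨h3, h3'⟩⟩ := hcon
    have aux : ∀ s t, s ≠ t → ¬ G.Adj x s → ¬ G.Adj x t →
        (G.Adj z s ∨ z ≠ s ∧ G.Adj x z ∧ G.Adj x s) →
        (G.Adj z t ∨ z ≠ t ∧ G.Adj x z ∧ G.Adj x t) → s ≠ x → t ≠ x → G.Adj s t := by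
      intro s t hst hs ht h1 h2 hsx htx
      have h1 : G.Adj z s := h1.resolve_right fun h => hs h.2.2
      have h2 : G.Adj z t := h2.resolve_right fun h => ht h.2.2
      rcases hcf z x s t hz.symm h1 h2 hsx.symm htx.symm hst with h | h | h
      · exact absurd h hs
      · exact absurd h ht
      · exact h
    by_cases ea : a = x
    · subst ea
      have hb : ¬ G.Adj a b := h1
      have hc : ¬ G.Adj a c := h2
      exact h3 (aux b c nbc hb hc hzb hzc nab.symm nac.symm)
    by_cases eb : b = x
    · subst eb
      have ha : ¬ G.Adj b a := fun h => h1 h.symm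
      have hc : ¬ G.Adj b c := h3
      exact h2 (aux a c nac ha hc hza hzc nab nbc.symm)
    by_cases ec : c = x
    · subst ec
      have ha : ¬ G.Adj c a := fun h => h2 h.symm
      have hb : ¬ G.Adj c b := fun h => h3 h.symm
      exact h1 (aux a b nab ha hb hza hzb nac nbc)
    by_cases ha : G.Adj x a <;> by_cases hb : G.Adj x b <;> by_cases hc : G.Adj x c
    · exact h1' nab ha hb
    · exact h1' nab ha hb
    · exact h2' nac ha hc
    · exact h3 (aux b c nbc hb hc hzb hzc eb ec)
    · exact h3' nbc hb hc
    · exact h2 (aux a c nac ha hc hza hzc ea ec)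
    · exact h1 (aux a b nab ha hb hza hzb ea eb)
    · exact h1 (aux a b nab ha hb hza hzb ea eb)
  · have h1 : G.Adj z a := hza.resolve_right fun h => hz h.2.1
    have h2 : G.Adj z b := hzb.resolve_right fun h => hz h.2.1
    have h3 : G.Adj z c := hzc.resolve_right fun h => hz h.2.1
    have := hcf z a b c h1 h2 h3 nab nac nbc
    rcases this with h | h | h
    · exact Or.inl (Or.inl h)
    · exact Or.inr (Or.inl (Or.inl h))
    · exact Or.inr (Or.inr (Or.inl h))

theorem closure {V : Type*} [Finite V] (G : SimpleGraph V) (hcf : ClawFree G) (hnt : ¬ Tr G) :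
    ∃ H, G ≤ H ∧ ClawFree H ∧ ¬ Tr H ∧
      ∀ x y u w, H.Adj x y → H.Adj x u → H.Adj y u → H.Adj x w → H.Adj y w → u ≠ w →
        H.Adj u w := by
  classical
  obtain ⟨H, hGH, hmax⟩ := Finite.exists_le_maximal
    (p := fun H : SimpleGraph V => ClawFree H ∧ ¬ Tr H) ⟨hcf, hnt⟩
  refine ⟨H, hGH, hmax.1.1, hmax.1.2, ?_⟩
  obtain ⟨⟨hcf, hnt⟩, hmax⟩ := hmax
  intro x y u w hxy hxu hyu hxw hyw huw
  by_contra hnuw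
  have hle : H ≤ comp H x := fun a b h => Or.inl h
  have htr : Tr (comp H x) := by
    by_contra hcon
    have := hmax (y := comp H x) ⟨comp_clawFree H hcf x, hcon⟩ hle
    exact hnuw (this (Or.inr ⟨huw, hxu, hxw⟩))
  obtain ⟨K, hHK, hKmax⟩ := Finite.exists_le_maximal
    (p := fun K : SimpleGraph V => K ≤ comp H x ∧ ¬ Tr K) ⟨hle, hnt⟩
  obtain ⟨⟨hK1, hK2⟩, hKmax⟩ := hKmax
  have trans : ∀ p q r, H.Adj x p → H.Adj x q → H.Adj x r → p ≠ q → K.Adj r p → K.Adj r q →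
      K.Adj p q := by
    intro p q r hp hq hr hpq h1 h2
    by_contra hcon
    have hle2 : K ≤ K ⊔ SimpleGraph.edge p q := le_sup_left
    have htr2 : Tr (K ⊔ SimpleGraph.edge p q) := by
      by_contra hc
      have := hKmax (y := K ⊔ SimpleGraph.edge p q) ⟨?_, hc⟩ hle2
      · apply hcon
        apply this
        right
        simp [SimpleGraph.edge_adj, hpq]
      · apply sup_le hK1
        intro a b hab
        rw [SimpleGraph.edge_adj] at hab
        obtain ⟨⟨rfl, rfl⟩ | ⟨rfl, rfl⟩, h⟩ := hab
        · exact Or.inr ⟨h, hp, hq⟩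
        · exact Or.inr ⟨h, hq, hp⟩
    apply hK2
    refine step H K hcf x hHK ?_ p q r hp hq hr hpq h1 h2 htr2
    intro a b hab
    exact (hK1 hab).imp id fun h => h.2
  have hally : ∀ z, H.Adj x z → z ≠ y → K.Adj y z := by
    intro z hz hzy
    by_cases e1 : z = u
    · rw [e1]; exact hHK hyu
    by_cases e2 : z = w
    · rw [e2]; exact hHK hyw
    rcases hcf x z u w hz hxu hxw e1 e2 huw with h | h | h
    · exact trans y z u hxy hz hxu hzy.symm (hHK hyu.symm) (hHK h.symm)
    · exact trans y z w hxy hz hxw hzy.symm (hHK hyw.symm) (hHK h.symm)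
    · exact absurd h hnuw
  apply hK2
  have : K = comp H x := by
    apply le_antisymm hK1
    intro a b hab
    rcases hab with h | ⟨h1, h2, h3⟩
    · exact hHK h
    · by_cases ea : a = y
      · subst ea; exact hally b h3 h1.symm
      by_cases eb : b = y
      · subst eb; exact (hally a h2 h1).symm
      exact trans a b y h2 h3 hxy h1 (hally a h2 ea) (hally b h3 eb)
  rw [this]; exact htr

end CF

namespace CF

/-! ### half-edges -/

section
set_option linter.unusedSectionVars false
variable {V : Type*} [Fintype V] [DecidableEq V]

def HE (V : Type*) := V × Bool

instance : Fintype (HE V) := inferInstanceAs (Fintype (V × Bool))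
instance : DecidableEq (HE V) := inferInstanceAs (DecidableEq (V × Bool))

def vx (x : HE V) : V := Prod.fst x
def bt (x : HE V) : Bool := Prod.snd x
def he (v : V) (b : Bool) : HE V := (v, b)

@[simp] theorem vx_he (v : V) (b : Bool) : vx (he v b) = v := rfl
@[simp] theorem bt_he (v : V) (b : Bool) : bt (he v b) = b := rfl
theorem he_eta (x : HE V) : he (vx x) (bt x) = x := rfl
theorem he_inj {v w : V} {b c : Bool} : he v b = he w c ↔ v = w ∧ b = c := Prod.mk_inj

def fl (x : HE V) : HE V := he (vx x) (!(bt x))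

@[simp] theorem fl_he (v : V) (b : Bool) : fl (he v b) = he v (!b) := rfl
@[simp] theorem vx_fl (x : HE V) : vx (fl x) = vx x := rfl
@[simp] theorem bt_fl (x : HE V) : bt (fl x) = !(bt x) := rfl
@[simp] theorem fl_fl (x : HE V) : fl (fl x) = x := by
  rw [← he_eta x]; simp
@[simp] theorem fl_ne (x : HE V) : fl x ≠ x := by
  intro h
  have := congrArg bt h
  simp at this
@[simp] theorem ne_fl (x : HE V) : x ≠ fl x := (fl_ne x).symm
@[simp] theorem fl_inj {x y : HE V} : fl x = fl y ↔ x = y :=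
  ⟨fun h => by rw [← fl_fl x, h, fl_fl], fun h => by rw [h]⟩
theorem fl_eq {x y : HE V} : fl x = y ↔ x = fl y :=
  ⟨fun h => by rw [← h, fl_fl], fun h => by rw [h, fl_fl]⟩
theorem eq_or_fl {x y : HE V} (h : vx x = vx y) : x = y ∨ x = fl y := by
  rw [← he_eta x, ← he_eta y, fl_he, he_inj, he_inj]
  cases bt x <;> cases bt y <;> simp [h]
theorem card_HE : Fintype.card (HE V) = 2 * Fintype.card V := by
  have : Fintype.card (HE V) = Fintype.card (V × Bool) := rfl
  rw [this, Fintype.card_prod, Fintype.card_bool, mul_comm]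

def Closed (nd : HE V → ℕ) (X : Finset (HE V)) : Prop :=
  ∀ x y, nd x = nd y → x ∈ X → y ∈ X

/-- number of half-edges from A to B -/
def ee (A B : Finset (HE V)) : ℕ := (A.filter fun x => fl x ∈ B).card

def d (X : Finset (HE V)) : ℕ := ee X Xᶜ

theorem d_eq (X : Finset (HE V)) : d X = (X.filter fun x => fl x ∉ X).card := by
  unfold d ee; congr 1; ext x; simp

theorem ee_comm (A B : Finset (HE V)) : ee A B = ee B A := by
  unfold ee
  apply Finset.card_bij (fun x _ => fl x)
  · intro x hx; simp at hx ⊢; exact hx.symm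
  · intro x _ y _ h; simpa using h
  · intro x hx; refine ⟨fl x, ?_, by simp⟩; simp at hx ⊢; exact hx.symm

theorem ee_union {A B : Finset (HE V)} (C : Finset (HE V)) (h : Disjoint A B) :
    ee (A ∪ B) C = ee A C + ee B C := by
  unfold ee
  rw [Finset.filter_union, Finset.card_union_of_disjoint]
  exact Finset.disjoint_filter_filter h

theorem ee_union_right {A B : Finset (HE V)} (C : Finset (HE V)) (h : Disjoint A B) :
    ee C (A ∪ B) = ee C A + ee C B := by
  rw [ee_comm, ee_union C h, ee_comm A, ee_comm B]

theorem d_compl (X : Finset (HE V)) : d Xᶜ = d X := by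
  unfold d; rw [ee_comm, compl_compl]

theorem uncross (X Y : Finset (HE V)) : ∃ pq pr po qr qo ro : ℕ,
    d X = pr + po + qr + qo ∧ d Y = pq + po + qr + ro ∧
    d (X ∩ Y) = pq + pr + po ∧ d (X \ Y) = pq + qr + qo ∧ d (Y \ X) = pr + qr + ro ∧
    d (X ∪ Y) = po + qo + ro ∧ po = ee (X ∩ Y) (X ∪ Y)ᶜ := by
  refine ⟨ee (X ∩ Y) (X \ Y), ee (X ∩ Y) (Y \ X), ee (X ∩ Y) (X ∪ Y)ᶜ, ee (X \ Y) (Y \ X),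
    ee (X \ Y) (X ∪ Y)ᶜ, ee (Y \ X) (X ∪ Y)ᶜ, ?_, ?_, ?_, ?_, ?_, ?_, rfl⟩
  all_goals unfold d
  · have e1 : X = (X ∩ Y) ∪ (X \ Y) := by ext; simp; tauto
    have e2 : Xᶜ = (Y \ X) ∪ (X ∪ Y)ᶜ := by ext; simp; tauto
    conv_lhs => rw [e2]
    rw [ee_union_right, show ee X = ee ((X ∩ Y) ∪ (X \ Y)) by rw [← e1], ee_union, ee_union]
    · omega
    all_goals rw [Finset.disjoint_left]; intro a; simp; try tauto
  · have e1 : Y = (X ∩ Y) ∪ (Y \ X) := by ext; simp; tauto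
    have e2 : Yᶜ = (X \ Y) ∪ (X ∪ Y)ᶜ := by ext; simp; tauto
    conv_lhs => rw [e2]
    rw [ee_union_right, show ee Y = ee ((X ∩ Y) ∪ (Y \ X)) by rw [← e1], ee_union, ee_union,
      ee_comm (Y \ X) (X \ Y)]
    · omega
    all_goals rw [Finset.disjoint_left]; intro a; simp; try tauto
  · have e2 : (X ∩ Y)ᶜ = (X \ Y) ∪ ((Y \ X) ∪ (X ∪ Y)ᶜ) := by ext; simp; tauto
    rw [e2, ee_union_right, ee_union_right]
    · omega
    all_goals rw [Finset.disjoint_left]; intro a; simp; try tauto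
  · have e2 : (X \ Y)ᶜ = (X ∩ Y) ∪ ((Y \ X) ∪ (X ∪ Y)ᶜ) := by ext; simp; tauto
    rw [e2, ee_union_right, ee_union_right, ee_comm (X ∩ Y)]
    · omega
    all_goals rw [Finset.disjoint_left]; intro a; simp; try tauto
  · have e2 : (Y \ X)ᶜ = (X ∩ Y) ∪ ((X \ Y) ∪ (X ∪ Y)ᶜ) := by ext; simp; tauto
    rw [e2, ee_union_right, ee_union_right, ee_comm (X ∩ Y), ee_comm (X \ Y)]
    · omega
    all_goals rw [Finset.disjoint_left]; intro a; simp; try tauto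
  · have e1 : X ∪ Y = (X ∩ Y) ∪ ((X \ Y) ∪ (Y \ X)) := by ext; simp; tauto
    rw [show ee (X ∪ Y) = ee ((X ∩ Y) ∪ ((X \ Y) ∪ (Y \ X))) by rw [← e1], ee_union, ee_union]
    · omega
    all_goals rw [Finset.disjoint_left]; intro a; simp; try tauto

theorem d_parity (X : Finset (HE V)) : X.card % 2 = d X % 2 := by
  rw [d_eq, ← Finset.card_filter_add_card_filter_not (s := X) (fun x => fl x ∈ X)]
  suffices h : Even (X.filter fun x => fl x ∈ X).card by
    obtain ⟨k, hk⟩ := h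
    omega
  rw [← Finset.card_filter_add_card_filter_not (fun x => bt x = true)]
  have : ((X.filter fun x => fl x ∈ X).filter fun x => bt x = true).card =
    ((X.filter fun x => fl x ∈ X).filter fun x => ¬ bt x = true).card := by
    apply Finset.card_bij (fun x _ => fl x)
    · intro x hx; simp at hx ⊢; simp [hx]
    · intro x _ y _ h; simpa using h
    · intro x hx; refine ⟨fl x, ?_, by simp⟩; simp at hx ⊢; simp [hx]
  rw [this]; exact ⟨_, rfl⟩

theorem Closed.inter {nd : HE V → ℕ} {X Y : Finset (HE V)} (hX : Closed nd X)
    (hY : Closed nd Y) : Closed nd (X ∩ Y) := by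
  intro x y h hx
  rw [Finset.mem_inter] at hx ⊢
  exact ⟨hX x y h hx.1, hY x y h hx.2⟩

theorem Closed.union {nd : HE V → ℕ} {X Y : Finset (HE V)} (hX : Closed nd X)
    (hY : Closed nd Y) : Closed nd (X ∪ Y) := by
  intro x y h hx
  rw [Finset.mem_union] at hx ⊢
  exact hx.imp (hX x y h) (hY x y h)

theorem Closed.compl {nd : HE V → ℕ} {X : Finset (HE V)} (hX : Closed nd X) :
    Closed nd Xᶜ := by
  intro x y h hx
  rw [Finset.mem_compl] at hx ⊢
  exact fun h' => hx (hX y x h.symm h')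

theorem Closed.sdiff {nd : HE V → ℕ} {X Y : Finset (HE V)} (hX : Closed nd X)
    (hY : Closed nd Y) : Closed nd (X \ Y) := by
  intro x y h hx
  rw [Finset.mem_sdiff] at hx ⊢
  exact ⟨hX x y h hx.1, fun h' => hx.2 (hY y x h.symm h')⟩

def fib (nd : HE V → ℕ) (n : ℕ) : Finset (HE V) := Finset.univ.filter fun x => nd x = n

@[simp] theorem mem_fib {nd : HE V → ℕ} {n : ℕ} {x : HE V} : x ∈ fib nd n ↔ nd x = n := by
  simp [fib]

theorem closed_fib (nd : HE V → ℕ) (n : ℕ) : Closed nd (fib nd n) := by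
  intro x y h; simp [h]

def img (nd : HE V → ℕ) : Finset ℕ := Finset.univ.image nd

def oddN (nd : HE V → ℕ) : Finset ℕ := (img nd).filter fun n => Odd (fib nd n).card

def Conn (nd : HE V → ℕ) : Prop :=
  ∀ X, Closed nd X → X.Nonempty → Xᶜ.Nonempty → 1 ≤ d X

def BL (nd : HE V → ℕ) : Prop :=
  ∀ X, Closed nd X → X.Nonempty → Xᶜ.Nonempty → 2 ≤ d X

def Compat (G : SimpleGraph V) (nd : HE V → ℕ) : Prop :=
  ∀ x y, vx x ≠ vx y → nd x = nd y → G.Adj (vx x) (vx y)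

theorem img_le (nd : HE V → ℕ) : (img nd).card ≤ Fintype.card (HE V) :=
  Finset.card_image_le

theorem exists_fresh (nd : HE V → ℕ) : ∃ f, ∀ x, nd x ≠ f := by
  obtain ⟨f, hf⟩ := Infinite.exists_notMem_finset (img nd)
  exact ⟨f, fun x h => hf (by simp [img]; exact ⟨_, h⟩)⟩

theorem card_closed {nd : HE V → ℕ} {X : Finset (HE V)} (hX : Closed nd X) :
    X.card = ∑ n ∈ X.image nd, (fib nd n).card := by
  rw [Finset.card_eq_sum_card_image nd X]
  apply Finset.sum_congr rfl
  intro n hn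
  congr 1
  ext x
  simp at hn ⊢
  intro hx
  obtain ⟨a, h, h'⟩ := hn
  exact hX _ _ (h'.trans hx.symm) h

theorem exists_odd {nd : HE V → ℕ} {X : Finset (HE V)} (hX : Closed nd X)
    (h : Odd (d X)) : ∃ x ∈ X, nd x ∈ oddN nd := by
  by_contra hcon
  push Not at hcon
  have h1 : Even X.card := by
    rw [card_closed hX]
    apply Finset.even_sum
    intro n hn
    obtain ⟨x, hx, rfl⟩ := Finset.mem_image.1 hn
    have := hcon x hx
    simp [oddN, img] at this
    exact this
  have h2 := d_parity X
  rw [Nat.even_iff] at h1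
  rw [Nat.odd_iff] at h
  omega

end
end CF

namespace CF

/-! ### Euler trails -/

section
set_option linter.unusedSectionVars false
variable {V : Type*} [Fintype V] [DecidableEq V]

theorem exists_max (P : (HE V → ℕ) → Prop) (h : ∃ nd, P nd) :
    ∃ nd, P nd ∧ ∀ nd', P nd' → (img nd').card ≤ (img nd).card := by
  classical
  have hk : ∃ k, ∃ nd, P nd ∧ Fintype.card (HE V) - (img nd).card = k := by
    obtain ⟨nd, h⟩ := h; exact ⟨_, nd, h, rfl⟩
  obtain ⟨nd, h1, h2⟩ := Nat.find_spec hk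
  refine ⟨nd, h1, fun nd' h' => ?_⟩
  have := Nat.find_min' hk ⟨nd', h', rfl⟩
  have := img_le nd
  have := img_le nd'
  omega

theorem img_lt {nd nd' : HE V → ℕ} (h1 : ∀ x, ∃ y, nd' y = nd x) (h2 : ∃ y, ∀ x, nd x ≠ nd' y) :
    (img nd).card < (img nd').card := by
  apply Finset.card_lt_card
  rw [Finset.ssubset_iff_of_subset]
  · obtain ⟨y, hy⟩ := h2
    refine ⟨nd' y, by simp [img], ?_⟩
    simp [img]; exact hy
  · intro n hn
    simp [img] at hn ⊢
    obtain ⟨x, rfl⟩ := hn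
    exact h1 x

theorem mem_oddN {nd : HE V → ℕ} {n : ℕ} : n ∈ oddN nd ↔ Odd (fib nd n).card := by
  simp only [oddN, Finset.mem_filter, and_iff_right_iff_imp]
  intro h
  have : (fib nd n).Nonempty := by
    rw [← Finset.card_pos]; exact h.pos
  obtain ⟨x, hx⟩ := this
  simp at hx
  simp [img]; exact ⟨x, hx⟩

def sp (nd : HE V → ℕ) (h1 h2 : HE V) (f : ℕ) : HE V → ℕ :=
  fun z => if z = h1 ∨ z = h2 then f else nd z

theorem sp_refine {nd : HE V → ℕ} {h1 h2 : HE V} {f : ℕ} (hf : ∀ x, nd x ≠ f)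
    (h12 : nd h1 = nd h2) {x y : HE V} (h : sp nd h1 h2 f x = sp nd h1 h2 f y) : nd x = nd y := by
  unfold sp at h
  have := hf x; have := hf y
  grind

theorem sp_compat {G : SimpleGraph V} {nd : HE V → ℕ} {h1 h2 : HE V} {f : ℕ} (hf : ∀ x, nd x ≠ f)
    (h12 : nd h1 = nd h2) (hc : Compat G nd) : Compat G (sp nd h1 h2 f) :=
  fun x y hxy h => hc x y hxy (sp_refine hf h12 h)

theorem sp_img {nd : HE V → ℕ} {h1 h2 h3 : HE V} {f : ℕ} (hf : ∀ x, nd x ≠ f)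
    (h12 : nd h1 = nd h2) (h13 : nd h1 = nd h3) (n1 : h3 ≠ h1) (n2 : h3 ≠ h2) :
    (img nd).card < (img (sp nd h1 h2 f)).card := by
  apply img_lt
  · intro x
    by_cases h : x = h1 ∨ x = h2
    · refine ⟨h3, ?_⟩
      unfold sp; rcases h with rfl | rfl <;> simp [n1, n2, ← h13, h12]
    · exact ⟨x, by simp [sp, h]⟩
  · exact ⟨h1, by simpa [sp] using hf⟩

theorem sp_odd {nd : HE V → ℕ} {h1 h2 : HE V} {f : ℕ} (hf : ∀ x, nd x ≠ f)
    (h12 : nd h1 = nd h2) (n : h1 ≠ h2) : oddN (sp nd h1 h2 f) ⊆ oddN nd := by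
  intro m hm
  rw [mem_oddN] at hm ⊢
  by_cases e : m = f
  · exfalso
    have : fib (sp nd h1 h2 f) m = {h1, h2} := by
      ext z; simp [sp]
      have := hf z
      grind
    rw [this, Finset.card_pair n] at hm
    exact absurd hm (by decide)
  by_cases e2 : m = nd h1
  · have : fib nd m = fib (sp nd h1 h2 f) m ∪ {h1, h2} := by
      ext z; simp [sp]
      grind
    rw [this, Finset.card_union_of_disjoint, Finset.card_pair n]
    · exact hm.add_even (by decide)
    · rw [Finset.disjoint_left]; intro z; simp [sp]; grind
  · have : fib nd m = fib (sp nd h1 h2 f) m := by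
      ext z; simp [sp]
      grind
    rwa [this]

/-- if splitting off `h1, h2` disconnects -/
theorem split_disc {nd : HE V → ℕ} (hc : Conn nd) {h1 h2 : HE V} {f : ℕ} (hf : ∀ x, nd x ≠ f)
    (h12 : nd h1 = nd h2) (n : h1 ≠ h2) (hfl : fl h1 ≠ h2) (hnc : ¬ Conn (sp nd h1 h2 f)) :
    ∃ X, Closed nd X ∧ (∀ z, nd z = nd h1 → z ∉ X) ∧ fl h1 ∈ X ∧ fl h2 ∈ X ∧
      ∀ x ∈ X, fl x ∉ X → x = fl h1 ∨ x = fl h2 := by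
  have key : ∀ X, Closed (sp nd h1 h2 f) X → X.Nonempty → Xᶜ.Nonempty → d X = 0 → h1 ∈ X →
    ∃ X, Closed nd X ∧ (∀ z, nd z = nd h1 → z ∉ X) ∧ fl h1 ∈ X ∧ fl h2 ∈ X ∧
      ∀ x ∈ X, fl x ∉ X → x = fl h1 ∨ x = fl h2 := by
    intro X hX hne hne' hd hh1
    have hd' : ∀ x ∈ X, fl x ∈ X := by
      rw [d_eq, Finset.card_eq_zero, Finset.filter_eq_empty_iff] at hd
      intro x hx; simpa using hd hx
    have hh2 : h2 ∈ X := hX h1 h2 (by simp [sp]) hh1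
    have hcl : ∀ z, nd z = nd h1 → z ∈ X → z = h1 ∨ z = h2 := by
      intro z hz hzX
      by_contra hcon
      have : Closed nd X := by
        intro x y hxy hx
        by_cases hy : y = h1 ∨ y = h2
        · rcases hy with rfl | rfl <;> assumption
        · by_cases hx' : x = h1 ∨ x = h2
          · refine hX z y ?_ hzX
            simp only [sp, hcon, hy, if_false]
            rcases hx' with rfl | rfl
            · rw [hz, hxy]
            · rw [hz, h12, hxy]
          · refine hX x y ?_ hx
            simp only [sp, hx', hy, if_false, hxy]
      have := hc X this hne hne'
      omega
    refine ⟨X \ {h1, h2}, ?_, ?_, ?_, ?_, ?_⟩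
    · intro x y hxy hx
      simp only [Finset.mem_sdiff, Finset.mem_insert, Finset.mem_singleton] at hx ⊢
      have hx1 : nd x ≠ nd h1 := fun h => hx.2 (hcl x h hx.1)
      have hy : ¬ (y = h1 ∨ y = h2) := by
        rintro (rfl | rfl)
        · exact hx1 hxy
        · exact hx1 (hxy.trans h12.symm)
      refine ⟨hX x y ?_ hx.1, hy⟩
      simp only [sp, hx.2, hy, if_false, hxy]
    · intro z hz hzX
      simp only [Finset.mem_sdiff, Finset.mem_insert, Finset.mem_singleton] at hzX
      exact hzX.2 (hcl z hz hzX.1)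
    · simp [hd' _ hh1, hfl]
    · simp [hd' _ hh2]
      rw [fl_eq]; exact fun h => hfl h.symm
    · intro x hx hx'
      simp only [Finset.mem_sdiff, Finset.mem_insert, Finset.mem_singleton] at hx hx'
      have := hd' x hx.1
      have : fl x = h1 ∨ fl x = h2 := by tauto
      rw [fl_eq, fl_eq] at this
      exact this
  unfold Conn at hnc
  push Not at hnc
  obtain ⟨X, hX, hne, hne', hd⟩ := hnc
  by_cases h : h1 ∈ X
  · exact key X hX hne hne' (by omega) h
  · exact key Xᶜ hX.compl hne' (by rwa [compl_compl]) (by rw [d_compl]; omega) (by simpa using h)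

theorem d_eq_one {X : Finset (HE V)} (a : HE V) (ha : a ∈ X) (ha' : fl a ∉ X)
    (h : ∀ x ∈ X, fl x ∉ X → x = a) : d X = 1 := by
  rw [d_eq, Finset.card_eq_one]
  refine ⟨a, ?_⟩
  ext x; simp only [Finset.mem_filter, Finset.mem_singleton]
  exact ⟨fun hx => h x hx.1 hx.2, fun hx => by rw [hx]; exact ⟨ha, ha'⟩⟩

theorem d_eq_zero {X : Finset (HE V)} (h : ∀ x ∈ X, fl x ∈ X) : d X = 0 := by
  rw [d_eq, Finset.card_eq_zero, Finset.filter_eq_empty_iff]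
  intro x hx; simpa using h x hx

theorem pick3 (s : Finset (HE V)) (h : 3 ≤ s.card) : ∃ h1 h2 h3, h1 ∈ s ∧ h2 ∈ s ∧ h3 ∈ s ∧
    h1 ≠ h2 ∧ h1 ≠ h3 ∧ h2 ≠ h3 ∧ fl h1 ≠ h2 ∧ fl h1 ≠ h3 := by
  obtain ⟨a, ha, b, hb, c, hc, hab, hac, hbc⟩ := Finset.two_lt_card.1 (show 2 < s.card by omega)
  by_cases e1 : fl a = b
  · refine ⟨c, a, b, hc, ha, hb, hac.symm, hbc.symm, hab, ?_, ?_⟩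
    · intro h; apply hbc; rw [← e1, ← h, fl_fl]
    · intro h; apply hac; rw [← fl_inj, h, e1]
  by_cases e2 : fl a = c
  · refine ⟨b, a, c, hb, ha, hc, hab.symm, hbc, hac, ?_, ?_⟩
    · intro h; apply hbc; rw [← e2, ← h, fl_fl]
    · intro h; apply hab; rw [← fl_inj, h, e2]
  exact ⟨a, b, c, ha, hb, hc, hab, hac, hbc, e1, e2⟩

theorem trail {G : SimpleGraph V} {nd : HE V → ℕ} (hG : Compat G nd) (hc : Conn nd)
    (h2 : ∀ n, (fib nd n).card ≤ 2) : Tr G := by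
  classical
  have hmax : ∃ l : List (HE V), ((l.map vx).Nodup ∧ l.IsChain (fun x y => nd (fl x) = nd y)) ∧
      ∀ l' : List (HE V), (l'.map vx).Nodup → l'.IsChain (fun x y => nd (fl x) = nd y) →
        l'.length ≤ l.length := by
    have hb : ∀ l : List (HE V), (l.map vx).Nodup → l.length ≤ Fintype.card V := by
      intro l hl; simpa using hl.length_le_card
    have hk : ∃ k, ∃ l : List (HE V), ((l.map vx).Nodup ∧
        l.IsChain (fun x y => nd (fl x) = nd y)) ∧ Fintype.card V - l.length = k :=
      ⟨_, [], by simp, rfl⟩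
    obtain ⟨l, h1, h2⟩ := Nat.find_spec hk
    refine ⟨l, h1, fun l' h1' h2' => ?_⟩
    have := Nat.find_min' hk ⟨l', ⟨h1', h2'⟩, rfl⟩
    have := hb l h1.1
    have := hb l' h1'
    omega
  obtain ⟨l, ⟨hnd, hch⟩, hmax⟩ := hmax
  have two : ∀ x z w : HE V, nd x = nd z → x ≠ z → nd w = nd z → w = x ∨ w = z := by
    intro x z w hxz hne hw
    by_contra hcon
    push Not at hcon
    have : ({w, x, z} : Finset (HE V)) ⊆ fib nd (nd z) := by
      intro y; simp; rintro (rfl | rfl | rfl) <;> simp [*]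
    have := Finset.card_le_card this
    have h3 : ({w, x, z} : Finset (HE V)).card = 3 :=
      Finset.card_eq_three.2 ⟨w, x, z, hcon.1, hcon.2, hne, rfl⟩
    have := h2 (nd z)
    omega
  let X : Finset (HE V) := Finset.univ.filter fun x => vx x ∈ l.map vx
  have hX : Closed nd X := by
    intro x z hxz hx
    by_contra hz
    simp only [X, Finset.mem_filter, Finset.mem_univ, true_and] at hx hz
    have hne : x ≠ z := by rintro rfl; exact hz hx
    obtain ⟨y, hy, hyx⟩ := List.mem_map.1 hx
    obtain ⟨A, B, rfl⟩ := List.append_of_mem hy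
    rcases eq_or_fl hyx with rfl | h
    · cases A using List.reverseRecOn with
      | nil =>
        have := hmax (fl z :: ([] ++ y :: B)) (by
          rw [List.map_cons, List.nodup_cons]; exact ⟨by simpa using hz, hnd⟩) (by
          rw [List.nil_append, List.isChain_cons_cons]
          exact ⟨by rw [fl_fl, hxz], hch⟩)
        simp at this
      | append_singleton A w _ =>
        have h1 : nd (fl w) = nd y := by
          simp [List.isChain_append] at hch; grind
        rcases two y z (fl w) hxz hne (h1.trans hxz) with h | h
        · have : vx w = vx y := by rw [← h, vx_fl]
          simp [List.nodup_append] at hnd; grind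
        · apply hz; rw [← h]; simp
    · have hxf : x = fl y := by rw [h, fl_fl]
      subst hxf
      cases B with
      | nil =>
        have := hmax ((A ++ [y]) ++ [z]) (by
          rw [List.map_append, List.nodup_append]
          refine ⟨hnd, by simp, ?_⟩
          intro a ha b hb
          simp at hb; subst hb
          rintro rfl; exact hz ha) (by
          rw [List.isChain_append]
          refine ⟨hch, by simp, ?_⟩
          intro p hp q hq
          simp at hp hq; subst hp; subst hq; exact hxz)
        simp at this
      | cons w B =>
        have h1 : nd (fl y) = nd w := by
          simp [List.isChain_append, List.isChain_cons_cons] at hch; grind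
        rcases two (fl y) z w hxz hne (h1.symm.trans hxz) with h | h
        · have : vx w = vx y := by rw [h, vx_fl]
          simp [List.nodup_append] at hnd; grind
        · apply hz; rw [← h]; simp
  have hd : d X = 0 := d_eq_zero (by intro x; simp [X])
  have hall : ∀ v, v ∈ l.map vx := by
    intro v
    by_contra hv
    have hne' : Xᶜ.Nonempty := ⟨he v true, by simpa [X] using hv⟩
    rcases Finset.eq_empty_or_nonempty X with h | h
    · have h0 : l = [] := by
        cases l with
        | nil => rfl
        | cons x l => exfalso; have : x ∈ X := by simp [X]
                      rw [h] at this; simp at this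
      have := hmax [he v true] (by simp) (by simp)
      rw [h0] at this; simp at this
    · have := hc X hX h hne'
      omega
  refine ⟨l.map vx, hnd, hall, ?_⟩
  rw [List.isChain_map]
  have hnd' : l.Pairwise (fun x y => vx x ≠ vx y) := List.pairwise_map.1 hnd
  clear hmax hall hd hX X hnd
  induction l with
  | nil => simp
  | cons a l ih =>
    cases l with
    | nil => simp
    | cons b l =>
      rw [List.isChain_cons_cons] at hch ⊢
      rw [List.pairwise_cons] at hnd'
      exact ⟨by simpa using hG (fl a) b (by simpa using hnd'.1 b (by simp)) hch.1, ih hch.2 hnd'.2⟩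

theorem euler {G : SimpleGraph V} {nd : HE V → ℕ} (hG : Compat G nd) (hc : Conn nd)
    (ho : (oddN nd).card ≤ 2) : Tr G := by
  obtain ⟨nd, ⟨hG, hc, ho⟩, hmax⟩ := exists_max
    (fun nd => Compat G nd ∧ Conn nd ∧ (oddN nd).card ≤ 2) ⟨nd, hG, hc, ho⟩
  apply trail hG hc
  intro n
  by_contra hcon
  obtain ⟨h1, h2, h3, m1, m2, m3, n12, n13, n23, f12, f13⟩ := pick3 (fib nd n) (by omega)
  simp only [mem_fib] at m1 m2 m3
  obtain ⟨f, hf⟩ := exists_fresh nd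
  have h12 : nd h1 = nd h2 := by rw [m1, m2]
  have h13 : nd h1 = nd h3 := by rw [m1, m3]
  have d1 : ¬ Conn (sp nd h1 h2 f) := fun h => by
    have := hmax _ ⟨sp_compat hf h12 hG, h, (Finset.card_le_card (sp_odd hf h12 n12)).trans ho⟩
    have := sp_img hf h12 h13 n13.symm n23.symm
    omega
  have d2 : ¬ Conn (sp nd h1 h3 f) := fun h => by
    have := hmax _ ⟨sp_compat hf h13 hG, h, (Finset.card_le_card (sp_odd hf h13 n13)).trans ho⟩
    have := sp_img hf h13 h12 n12.symm n23
    omega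
  obtain ⟨X, hX, aX, X1, X2, bX⟩ := split_disc hc hf h12 n12 f12 d1
  obtain ⟨Y, hY, aY, Y1, Y3, bY⟩ := split_disc hc hf h13 n13 f13 d2
  have aX1 := aX h1 rfl
  have aX2 := aX h2 h12.symm
  have aX3 := aX h3 h13.symm
  have aY1 := aY h1 rfl
  have aY2 := aY h2 h12.symm
  have aY3 := aY h3 h13.symm
  have Y2 : fl h2 ∉ Y := by
    intro h
    have := bY _ h (by simpa using aY2)
    simp at this; grind
  have X3 : fl h3 ∉ X := by
    intro h
    have := bX _ h (by simpa using aX3)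
    simp at this; grind
  have e1 : d (X ∩ Y) = 1 := by
    apply d_eq_one (fl h1) (by simp [X1, Y1]) (by simp [aX1])
    intro x hx hx'
    simp only [Finset.mem_inter] at hx hx'
    have h1 := bX x hx.1
    have h2 := bY x hx.2
    grind
  have e2 : d (X \ Y) = 1 := by
    apply d_eq_one (fl h2) (by simp [X2, Y2]) (by simp [aX2])
    intro x hx hx'
    simp only [Finset.mem_sdiff] at hx hx'
    have h1 := bX x hx.1
    have h2 := bY (fl x)
    simp only [fl_fl, fl_inj] at h2
    grind
  have e3 : d (Y \ X) = 1 := by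
    apply d_eq_one (fl h3) (by simp [Y3, X3]) (by simp [aY3])
    intro x hx hx'
    simp only [Finset.mem_sdiff] at hx hx'
    have h1 := bY x hx.1
    have h2 := bX (fl x)
    simp only [fl_fl, fl_inj] at h2
    grind
  obtain ⟨p, hp, op⟩ := exists_odd (hX.inter hY) (by rw [e1]; decide)
  obtain ⟨q, hq, oq⟩ := exists_odd (hX.sdiff hY) (by rw [e2]; decide)
  obtain ⟨r, hr, or⟩ := exists_odd (hY.sdiff hX) (by rw [e3]; decide)
  simp only [Finset.mem_inter, Finset.mem_sdiff] at hp hq hr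
  have npq : nd p ≠ nd q := fun h => hq.2 (hY _ _ h hp.2)
  have npr : nd p ≠ nd r := fun h => hr.2 (hX _ _ h hp.1)
  have nqr : nd q ≠ nd r := fun h => hr.2 (hX _ _ h hq.1)
  have : ({nd p, nd q, nd r} : Finset ℕ) ⊆ oddN nd := by
    intro n; simp; rintro (rfl | rfl | rfl) <;> assumption
  have := Finset.card_le_card this
  rw [Finset.card_eq_three.2 ⟨_, _, _, npq, npr, nqr, rfl⟩] at this
  omega

end
end CF

namespace CF

/-! ### the half-edge structure of a closed graph -/

section
set_option linter.unusedSectionVars false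
variable {V : Type*} [Fintype V] [DecidableEq V]

def Diam (H : SimpleGraph V) : Prop :=
  ∀ x y u w, H.Adj x y → H.Adj x u → H.Adj y u → H.Adj x w → H.Adj y w → u ≠ w → H.Adj u w

open Classical in
noncomputable def Qc (H : SimpleGraph V) (v w : V) : Finset V :=
  Finset.univ.filter fun z => z = v ∨ z = w ∨ (H.Adj v z ∧ H.Adj w z)

theorem mem_Qc {H : SimpleGraph V} {v w z : V} :
    z ∈ Qc H v w ↔ z = v ∨ z = w ∨ (H.Adj v z ∧ H.Adj w z) := by simp [Qc]

theorem Qc_comm (H : SimpleGraph V) (v w : V) : Qc H v w = Qc H w v := by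
  ext z; rw [mem_Qc, mem_Qc]; tauto

theorem Qc_clique {H : SimpleGraph V} (hd : Diam H) {v w a b : V} (h : H.Adj v w)
    (ha : a ∈ Qc H v w) (hb : b ∈ Qc H v w) (hab : a ≠ b) : H.Adj a b := by
  rw [mem_Qc] at ha hb
  rcases ha with rfl | rfl | ha <;> rcases hb with rfl | rfl | hb
  · exact absurd rfl hab
  · exact h
  · exact hb.1
  · exact h.symm
  · exact absurd rfl hab
  · exact hb.2
  · exact ha.1.symm
  · exact ha.2.symm
  · exact hd v w a b h ha.1 ha.2 hb.1 hb.2 hab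

theorem Qc_eq {H : SimpleGraph V} (hd : Diam H) {v w w' : V} (h : H.Adj v w)
    (hw : w' ∈ Qc H v w) (hne : w' ≠ v) : Qc H v w' = Qc H v w := by
  have hv : v ∈ Qc H v w := by rw [mem_Qc]; tauto
  have hw0 : w ∈ Qc H v w := by rw [mem_Qc]; tauto
  have h' : H.Adj v w' := Qc_clique hd h hv hw hne.symm
  have hwQ : w ∈ Qc H v w' := by
    by_cases e : w = w'
    · rw [mem_Qc]; tauto
    · rw [mem_Qc]; exact Or.inr (Or.inr ⟨h, Qc_clique hd h hw hw0 (Ne.symm e)⟩)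
  have hv' : v ∈ Qc H v w' := by rw [mem_Qc]; tauto
  ext z
  constructor
  · intro hz
    rw [mem_Qc]
    by_cases e1 : z = v
    · exact Or.inl e1
    by_cases e2 : z = w
    · exact Or.inr (Or.inl e2)
    exact Or.inr (Or.inr ⟨Qc_clique hd h' hv' hz (Ne.symm e1), Qc_clique hd h' hwQ hz (Ne.symm e2)⟩)
  · intro hz
    rw [mem_Qc]
    by_cases e1 : z = v
    · exact Or.inl e1
    by_cases e2 : z = w'
    · exact Or.inr (Or.inl e2)
    exact Or.inr (Or.inr ⟨Qc_clique hd h hv hz (Ne.symm e1), Qc_clique hd h hw hz (Ne.symm e2)⟩)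

def AB (nd : HE V → ℕ) : Prop :=
  ∀ X, Closed nd X → X.Nonempty → Xᶜ.Nonempty → 2 ≤ d X ∨ X.card = 1 ∨ Xᶜ.card = 1

theorem nd0 (H : SimpleGraph V) (hcf : ClawFree H) (hd : Diam H)
    (hnb : ∀ v, ∃ w, H.Adj v w) :
    ∃ nd, Compat H nd ∧ ∀ v w, H.Adj v w → ∃ i j, nd (he v i) = nd (he w j) := by
  have hq : ∀ v, ∃ q : Bool → Finset V, (∀ i, q i = {v} ∨ ∃ w, H.Adj v w ∧ q i = Qc H v w) ∧
      ∀ w, H.Adj v w → ∃ i, q i = Qc H v w := by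
    intro v
    obtain ⟨a, ha⟩ := hnb v
    by_cases hall : ∀ w, H.Adj v w → w ∈ Qc H v a
    · refine ⟨fun i => if i then Qc H v a else {v}, ?_, ?_⟩
      · intro i; cases i
        · left; simp
        · right; exact ⟨a, ha, by simp⟩
      · intro w hw
        exact ⟨true, by simp [Qc_eq hd ha (hall w hw) hw.ne.symm]⟩
    · push Not at hall
      obtain ⟨b, hb, hba⟩ := hall
      refine ⟨fun i => if i then Qc H v a else Qc H v b, ?_, ?_⟩
      · intro i; right; cases i
        · exact ⟨b, hb, by simp⟩
        · exact ⟨a, ha, by simp⟩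
      · intro w hw
        by_cases h1 : w ∈ Qc H v a
        · exact ⟨true, by simp [Qc_eq hd ha h1 hw.ne.symm]⟩
        by_cases h2 : w ∈ Qc H v b
        · exact ⟨false, by simp [Qc_eq hd hb h2 hw.ne.symm]⟩
        exfalso
        rw [mem_Qc] at h1 h2 hba
        push Not at h1 h2 hba
        rcases hcf v a b w ha hb hw (fun h => hba.2.1 h.symm) (fun h => h1.2.1 h.symm)
          (fun h => h2.2.1 h.symm) with h | h | h
        · exact hba.2.2 hb h
        · exact h1.2.2 hw h
        · exact h2.2.2 hw h
  choose q hq1 hq2 using hq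
  have hmem : ∀ v i, v ∈ q v i := by
    intro v i
    rcases hq1 v i with h | ⟨w, _, h⟩
    · rw [h]; simp
    · rw [h, mem_Qc]; tauto
  obtain ⟨enc, henc⟩ := Countable.exists_injective_nat (Finset V)
  refine ⟨fun x => enc (q (vx x) (bt x)), ?_, ?_⟩
  · intro x y hxy h
    have h := henc h
    rcases hq1 (vx x) (bt x) with h1 | ⟨a, ha, h1⟩
    · exfalso
      have := hmem (vx y) (bt y)
      rw [← h, h1] at this
      simp at this
      exact hxy this.symm
    · apply Qc_clique hd ha _ _ hxy
      · rw [mem_Qc]; tauto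
      · rw [← h1, h]; exact hmem _ _
  · intro v w hvw
    obtain ⟨i, hi⟩ := hq2 v w hvw
    obtain ⟨j, hj⟩ := hq2 w v hvw.symm
    exact ⟨i, j, by simp [hi, hj, Qc_comm H w v]⟩

theorem nd0_AB (H : SimpleGraph V)
    (hcon : ∀ S : Set V, S.Nonempty → Sᶜ.Nonempty → ∃ a ∈ S, ∃ b ∉ S, H.Adj a b)
    (hcut : ∀ v, ∀ S : Set V, v ∉ S → S.Nonempty → (∃ w, w ∉ S ∧ w ≠ v) →
      ∃ a ∈ S, ∃ b ∉ S, b ≠ v ∧ H.Adj a b)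
    {nd : HE V → ℕ} (hnd : ∀ v w, H.Adj v w → ∃ i j, nd (he v i) = nd (he w j)) : AB nd := by
  intro X hX hne hne'
  by_contra hcontra
  push Not at hcontra
  obtain ⟨h2, hc1, hc2⟩ := hcontra
  -- no edge between full and empty vertices
  have hno : ∀ a b, (∀ i, he a i ∈ X) → (∀ i, he b i ∉ X) → ¬ H.Adj a b := by
    intro a b ha hb hab
    obtain ⟨i, j, hij⟩ := hnd a b hab
    exact hb j (hX _ _ hij (ha i))
  by_cases hm : ∃ x ∈ X, fl x ∉ X
  · obtain ⟨x, hx, hfx⟩ := hm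
    have huniq : ∀ y, vx y ≠ vx x → (y ∈ X ↔ fl y ∈ X) := by
      have key : ∀ y, vx y ≠ vx x → y ∈ X → fl y ∈ X := by
        intro y hy hyX
        by_contra hfy
        have : ({x, y} : Finset (HE V)) ⊆ X.filter fun x => fl x ∉ X := by
          intro z; simp; rintro (rfl | rfl) <;> tauto
        have := Finset.card_le_card this
        rw [Finset.card_pair (by rintro rfl; exact hy rfl), ← d_eq] at this
        omega
      intro y hy
      exact ⟨key y hy, fun h => by have := key (fl y) (by simpa using hy) h; simpa using this⟩
    have hboth : ∀ v, v ≠ vx x → (∀ i, he v i ∈ X) ∨ (∀ i, he v i ∉ X) := by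
      intro v hv
      have := huniq (he v true) (by simpa using hv)
      simp only [fl_he, Bool.not_true] at this
      by_cases h : he v true ∈ X
      · left; intro i; cases i <;> tauto
      · right; intro i; cases i <;> tauto
    by_cases hS : ∃ v, v ≠ vx x ∧ he v true ∈ X
    · by_cases hT : ∃ v, v ≠ vx x ∧ he v true ∉ X
      · obtain ⟨s, hs, hsX⟩ := hS
        obtain ⟨t, ht, htX⟩ := hT
        obtain ⟨a, ha, b, hb, hbv, hab⟩ := hcut (vx x) {v | v ≠ vx x ∧ he v true ∈ X} (by simp)
          ⟨s, hs, hsX⟩ ⟨t, by simp [htX], ht⟩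
        simp at ha hb
        refine hno a b ?_ ?_ hab
        · rcases hboth a ha.1 with h | h
          · exact h
          · exact absurd ha.2 (h true)
        · rcases hboth b hbv with h | h
          · exact absurd (h true) (hb hbv)
          · exact h
      · push Not at hT
        apply hc2
        rw [Finset.card_eq_one]
        refine ⟨fl x, ?_⟩
        ext y
        simp only [Finset.mem_compl, Finset.mem_singleton]
        constructor
        · intro hy
          by_cases e : vx y = vx x
          · rcases eq_or_fl e with rfl | h
            · exact absurd hx hy
            · exact h
          · exfalso
            rcases hboth (vx y) e with h | h
            · exact hy (h (bt y))
            · exact h true (hT _ e)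
        · rintro rfl; exact hfx
    · push Not at hS
      apply hc1
      rw [Finset.card_eq_one]
      refine ⟨x, ?_⟩
      ext y
      simp only [Finset.mem_singleton]
      constructor
      · intro hy
        by_cases e : vx y = vx x
        · rcases eq_or_fl e with rfl | h
          · rfl
          · rw [h] at hy; exact absurd hy hfx
        · exfalso
          rcases hboth (vx y) e with h | h
          · exact hS _ e (h true)
          · exact h (bt y) hy
      · rintro rfl; exact hx
  · push Not at hm
    have hiff : ∀ v i, he v i ∈ X ↔ he v true ∈ X := by
      intro v i
      cases i
      · exact ⟨hm (he v false), hm (he v true)⟩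
      · rfl
    obtain ⟨s, hs⟩ := hne
    obtain ⟨t, ht⟩ := hne'
    rw [Finset.mem_compl] at ht
    obtain ⟨a, ha, b, hb, hab⟩ := hcon {v | he v true ∈ X} ⟨vx s, (hiff (vx s) (bt s)).1 hs⟩
      ⟨vx t, fun h => ht ((hiff (vx t) (bt t)).2 h)⟩
    exact hno a b (fun i => (hiff a i).2 ha) (fun i h => hb ((hiff b i).1 h)) hab

def Sg (nd : HE V → ℕ) (x : HE V) : Prop := ∀ y, nd y = nd x → y = x

theorem sg_of_closed {nd : HE V → ℕ} {x : HE V} (h : Closed nd {x}) : Sg nd x := by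
  intro y hy
  simpa using h x y hy.symm (by simp)

theorem absorb_step {H : SimpleGraph V} (hnt : ¬ Tr H) {nd : HE V → ℕ} (hG : Compat H nd)
    (hab : AB nd) {z : HE V} (hz : Sg nd z) :
    ∃ nd', Compat H nd' ∧ AB nd' ∧ (∀ x, Sg nd' x → Sg nd x) ∧ ¬ Sg nd' z := by
  classical
  have hzf : nd (fl z) ≠ nd z := fun h => fl_ne z (hz _ h)
  have hg : ∃ g, nd g = nd (fl z) ∧ g ≠ fl z ∧ ¬ Sg nd (fl g) := by
    by_contra hcon
    push Not at hcon
    have hcon' : ∀ g, nd g = nd (fl z) → Sg nd (fl g) := by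
      intro g hg
      by_cases e : g = fl z
      · rw [e, fl_fl]; exact hz
      · exact hcon g hg e
    let X : Finset (HE V) := Finset.univ.filter fun x => nd x = nd (fl z) ∨ nd (fl x) = nd (fl z)
    have hX : Closed nd X := by
      intro x y hxy hx
      simp only [X, Finset.mem_filter, Finset.mem_univ, true_and] at hx ⊢
      rcases hx with h | h
      · left; rw [← hxy, h]
      · have := hcon' _ h y (by rw [fl_fl, hxy])
        right; rw [this, fl_fl]; exact h
    have hfl : ∀ x ∈ X, fl x ∈ X := by
      intro x
      simp only [X, Finset.mem_filter, Finset.mem_univ, true_and, fl_fl]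
      tauto
    have hd0 := d_eq_zero hfl
    have hzX : z ∈ X := by simp [X]
    by_cases hall : Xᶜ.Nonempty
    · rcases hab X hX ⟨z, hzX⟩ hall with h | h | h
      · omega
      · obtain ⟨w, hw⟩ := Finset.card_eq_one.1 h
        have h1 := hfl z hzX
        rw [hw] at h1 hzX
        simp at h1 hzX
        rw [← hzX] at h1
        exact fl_ne z h1
      · obtain ⟨w, hw⟩ := Finset.card_eq_one.1 h
        have h1 : w ∉ X := by rw [← Finset.mem_compl, hw]; simp
        have h2 : fl w ∈ Xᶜ := by
          rw [Finset.mem_compl]; intro h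
          have := hfl _ h
          rw [fl_fl] at this
          exact h1 this
        rw [hw] at h2
        simp at h2
    · rw [Finset.not_nonempty_iff_eq_empty, Finset.compl_eq_empty_iff] at hall
      apply hnt
      have hh : ∀ v, ∃ x, vx x = v ∧ nd x = nd (fl z) := by
        intro v
        have : he v true ∈ X := by rw [hall]; simp
        simp only [X, Finset.mem_filter, Finset.mem_univ, true_and] at this
        rcases this with h | h
        · exact ⟨_, rfl, h⟩
        · exact ⟨_, rfl, h⟩
      refine ⟨Finset.univ.toList, Finset.nodup_toList _, by simp, ?_⟩
      apply List.Pairwise.isChain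
      apply List.Pairwise.imp _ (Finset.nodup_toList Finset.univ)
      intro v w hvw
      obtain ⟨x, rfl, hx⟩ := hh v
      obtain ⟨y, rfl, hy⟩ := hh w
      exact hG x y hvw (by rw [hx, hy])
  obtain ⟨g, hg1, hg2, hg3⟩ := hg
  have hgz : g ≠ z := by rintro rfl; exact hzf hg1.symm
  have hthird : ∃ y, nd y = nd (fl z) ∧ y ≠ fl z ∧ y ≠ g := by
    by_contra hcon
    push Not at hcon
    let X : Finset (HE V) := {z, fl z, g}
    have hX : Closed nd X := by
      intro x y hxy hx
      simp only [X, Finset.mem_insert, Finset.mem_singleton] at hx ⊢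
      rcases hx with rfl | rfl | rfl
      · left; exact hz y hxy.symm
      · have := hcon y hxy.symm; tauto
      · have := hcon y (hxy.symm.trans hg1); tauto
    have hfg : fl g ∉ X := by
      simp only [X, Finset.mem_insert, Finset.mem_singleton, fl_inj]
      rw [fl_eq]; push Not; exact ⟨hg2, hgz, fl_ne g⟩
    have hd : d X = 1 := by
      apply d_eq_one g (by simp [X]) hfg
      intro x hx hx'
      simp only [X, Finset.mem_insert, Finset.mem_singleton] at hx hx'
      rcases hx with rfl | rfl | rfl
      · tauto
      · simp at hx'
      · rfl
    have hcard : X.card = 3 := Finset.card_eq_three.2 ⟨_, _, _, ne_fl z, hgz.symm, hg2.symm, rfl⟩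
    rcases hab X hX ⟨z, by simp [X]⟩ ⟨fl g, by simpa using hfg⟩ with h | h | h
    · omega
    · omega
    · obtain ⟨w, hw⟩ := Finset.card_eq_one.1 h
      have h1 : fl g ∈ Xᶜ := by simpa using hfg
      have h2 := hX.compl
      rw [hw] at h1 h2
      simp at h1
      rw [← h1] at h2
      exact hg3 (sg_of_closed h2)
  have ug : Function.update nd g (nd z) g = nd z := by simp
  have un : ∀ x, x ≠ g → Function.update nd g (nd z) x = nd x := by
    intro x hx; simp [hx]
  refine ⟨Function.update nd g (nd z), ?_, ?_, ?_, ?_⟩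
  · intro x y hxy h
    by_cases ex : x = g <;> by_cases ey : y = g
    · rw [ex, ey] at hxy; exact absurd rfl hxy
    · rw [ex, ug, un y ey] at h
      have := hz y h.symm
      subst this; subst ex
      have := hG x (fl y) (by simpa using hxy) hg1
      simpa using this
    · rw [ey, ug, un x ex] at h
      have := hz x h
      subst this; subst ey
      have := hG (fl x) y (by simpa using hxy) hg1.symm
      simpa using this
    · rw [un x ex, un y ey] at h
      exact hG x y hxy h
  · have key : ∀ X, Closed (Function.update nd g (nd z)) X → X.Nonempty → Xᶜ.Nonempty → d X ≤ 1 →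
        z ∈ X → X.card = 1 ∨ Xᶜ.card = 1 := by
      intro X hX hne hne' hd hzX
      have hgX : g ∈ X := hX z g (by rw [ug, un z hgz.symm]) hzX
      have hXn : ∀ x y, x ≠ g → y ≠ g → nd x = nd y → x ∈ X → y ∈ X := fun x y hx hy h hh =>
        hX x y (by rw [un x hx, un y hy, h]) hh
      by_cases hfz : fl z ∈ X
      · have hXc : Closed nd X := by
          intro x y hxy hx
          by_cases ey : y = g
          · rw [ey]; exact hgX
          by_cases ex : x = g
          · exact hXn (fl z) y hg2.symm ey (by rw [← hxy, ex, hg1]) hfz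
          · exact hXn x y ex ey hxy hx
        rcases hab X hXc hne hne' with h | h
        · omega
        · exact h
      · exfalso
        have hbd : ∀ x ∈ X, fl x ∉ X → x = z := by
          intro x hx hx'
          by_contra hxz
          have : ({x, z} : Finset (HE V)) ⊆ X.filter fun x => fl x ∉ X := by
            intro w; simp; rintro (rfl | rfl) <;> tauto
          have := Finset.card_le_card this
          rw [Finset.card_pair hxz, ← d_eq] at this
          omega
        have hfg : fl g ∈ X := by
          by_contra h; exact hgz (hbd g hgX h)
        have hfgz : fl g ≠ z := by rw [Ne, fl_eq]; exact hg2
        let Y := X \ {z, g}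
        have hY : Closed nd Y := by
          intro x y hxy hx
          simp only [Y, Finset.mem_sdiff, Finset.mem_insert, Finset.mem_singleton] at hx ⊢
          push Not at hx ⊢
          obtain ⟨hx, hxz, hxg⟩ := hx
          have hyg : y ≠ g := by
            rintro rfl
            exact hfz (hXn x (fl z) hxg hg2.symm (by rw [hxy, hg1]) hx)
          refine ⟨hXn x y hxg hyg hxy hx, ?_, hyg⟩
          rintro rfl
          exact hxz (hz x hxy)
        have hfgY : fl g ∈ Y := by simp [Y, hfg, hfgz]
        have hzY : z ∉ Y := by simp [Y]
        have hgY : g ∉ Y := by simp [Y]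
        have hdY : d Y = 1 := by
          apply d_eq_one (fl g) hfgY (by simpa using hgY)
          intro x hx hx'
          simp only [Y, Finset.mem_sdiff, Finset.mem_insert, Finset.mem_singleton] at hx hx'
          by_cases e : fl x = g
          · rw [← e, fl_fl]
          by_cases e2 : fl x = z
          · rw [fl_eq] at e2; rw [e2] at hx; exact absurd hx.1 hfz
          · have := hbd x hx.1 (by tauto)
            exact absurd (Or.inl this) hx.2
        rcases hab Y hY ⟨_, hfgY⟩ ⟨z, by simpa using hzY⟩ with h | h | h
        · omega
        · obtain ⟨w, hw⟩ := Finset.card_eq_one.1 h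
          rw [hw] at hfgY hY
          simp at hfgY
          rw [← hfgY] at hY
          exact hg3 (sg_of_closed hY)
        · have : ({z, g} : Finset (HE V)) ⊆ Yᶜ := by
            intro w; simp; rintro (rfl | rfl) <;> assumption
          have := Finset.card_le_card this
          rw [Finset.card_pair hgz.symm] at this
          omega
    intro X hX hne hne'
    by_cases h2 : 2 ≤ d X
    · exact Or.inl h2
    right
    by_cases hzX : z ∈ X
    · exact key X hX hne hne' (by omega) hzX
    · have := key Xᶜ hX.compl hne' (by rwa [compl_compl]) (by rw [d_compl]; omega) (by simpa using hzX)
      rw [compl_compl] at this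
      exact this.symm
  · intro x hx y hy
    by_cases ex : x = g
    · exfalso
      have := hx z (by rw [ex, ug, un z hgz.symm])
      rw [ex] at this; exact hgz this.symm
    by_cases ey : y = g
    · exfalso
      obtain ⟨w, hw1, hw2, hw3⟩ := hthird
      have e1 := hx w (by rw [un w hw3, un x ex, ← hy, ey, hg1, hw1])
      have e2 := hx (fl z) (by rw [un _ hg2.symm, un x ex, ← hy, ey, hg1])
      exact hw2 (e1.trans e2.symm)
    · exact hx y (by rw [un x ex, un y ey, hy])
  · intro h
    exact hgz (h g (by rw [ug, un z hgz.symm]))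

theorem absorb {H : SimpleGraph V} (hnt : ¬ Tr H) {nd : HE V → ℕ} (hG : Compat H nd)
    (hab : AB nd) : ∃ nd, Compat H nd ∧ BL nd := by
  classical
  have hk : ∃ k, ∃ nd, (Compat H nd ∧ AB nd) ∧ (Finset.univ.filter fun x => Sg nd x).card = k :=
    ⟨_, nd, ⟨hG, hab⟩, rfl⟩
  obtain ⟨nd, ⟨hG, hab⟩, hcard⟩ := Nat.find_spec hk
  have hno : ∀ z, ¬ Sg nd z := by
    intro z hz
    obtain ⟨nd', h1, h2, h3, h4⟩ := absorb_step hnt hG hab hz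
    have h5 := Nat.find_min' hk ⟨nd', ⟨h1, h2⟩, rfl⟩
    have : (Finset.univ.filter fun x => Sg nd' x) ⊂ (Finset.univ.filter fun x => Sg nd x) := by
      rw [Finset.ssubset_iff_of_subset]
      · exact ⟨z, by simpa using hz, by simpa using h4⟩
      · intro x; simpa using h3 x
    have := Finset.card_lt_card this
    omega
  refine ⟨nd, hG, ?_⟩
  intro X hX hne hne'
  rcases hab X hX hne hne' with h | h | h
  · exact h
  · obtain ⟨w, hw⟩ := Finset.card_eq_one.1 h
    rw [hw] at hX
    exact absurd (sg_of_closed hX) (hno w)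
  · obtain ⟨w, hw⟩ := Finset.card_eq_one.1 h
    have := hX.compl
    rw [hw] at this
    exact absurd (sg_of_closed this) (hno w)

end
end CF

namespace CF

/-! ### bridgeless structures with many nodes -/

section
set_option linter.unusedSectionVars false
variable {V : Type*} [Fintype V] [DecidableEq V]

theorem two_le_d {X : Finset (HE V)} {x y : HE V} (hne : x ≠ y) (hx : x ∈ X) (hx' : fl x ∉ X)
    (hy : y ∈ X) (hy' : fl y ∉ X) : 2 ≤ d X := by
  have : ({x, y} : Finset (HE V)) ⊆ X.filter fun x => fl x ∉ X := by
    intro w; simp; rintro (rfl | rfl) <;> tauto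
  have := Finset.card_le_card this
  rwa [Finset.card_pair hne, ← d_eq] at this

theorem one_le_d {X : Finset (HE V)} {x : HE V} (hx : x ∈ X) (hx' : fl x ∉ X) : 1 ≤ d X := by
  rw [d_eq, Nat.succ_le_iff, Finset.card_pos]
  exact ⟨x, by simp [hx, hx']⟩

/-- if splitting off `h1, h2` creates a bridge -/
theorem split_bad {nd : HE V → ℕ} (hc : BL nd) {h1 h2 : HE V} {f : ℕ} (hf : ∀ x, nd x ≠ f)
    (h12 : nd h1 = nd h2) (n : h1 ≠ h2) (hfl : fl h1 ≠ h2) (hnc : ¬ BL (sp nd h1 h2 f)) :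
    ∃ X, Closed nd X ∧ (∀ z, nd z = nd h1 → z ∉ X) ∧ fl h1 ∈ X ∧ fl h2 ∈ X ∧ d X ≤ 3 := by
  have key : ∀ X, Closed (sp nd h1 h2 f) X → X.Nonempty → Xᶜ.Nonempty → d X ≤ 1 → h1 ∈ X →
    ∃ X, Closed nd X ∧ (∀ z, nd z = nd h1 → z ∉ X) ∧ fl h1 ∈ X ∧ fl h2 ∈ X ∧ d X ≤ 3 := by
    intro X hX hne hne' hd hh1
    have hh2 : h2 ∈ X := hX h1 h2 (by simp [sp]) hh1
    have hcl : ∀ z, nd z = nd h1 → z ∈ X → z = h1 ∨ z = h2 := by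
      intro z hz hzX
      by_contra hcon
      have : Closed nd X := by
        intro x y hxy hx
        by_cases hy : y = h1 ∨ y = h2
        · rcases hy with rfl | rfl <;> assumption
        · by_cases hx' : x = h1 ∨ x = h2
          · refine hX z y ?_ hzX
            simp only [sp, hcon, hy, if_false]
            rcases hx' with rfl | rfl
            · rw [hz, hxy]
            · rw [hz, h12, hxy]
          · refine hX x y ?_ hx
            simp only [sp, hx', hy, if_false, hxy]
      have := hc X this hne hne'
      omega
    have hcl0 : Closed nd (X \ {h1, h2}) := by
      intro x y hxy hx
      simp only [Finset.mem_sdiff, Finset.mem_insert, Finset.mem_singleton] at hx ⊢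
      have hx1 : nd x ≠ nd h1 := fun h => hx.2 (hcl x h hx.1)
      have hy : ¬ (y = h1 ∨ y = h2) := by
        rintro (rfl | rfl)
        · exact hx1 hxy
        · exact hx1 (hxy.trans h12.symm)
      refine ⟨hX x y ?_ hx.1, hy⟩
      simp only [sp, hx.2, hy, if_false, hxy]
    have hf21 : fl h2 ≠ h1 := by rw [Ne, fl_eq]; exact fun h => hfl h.symm
    have hbd : ∀ x y, x ∈ X → fl x ∉ X → y ∈ X → fl y ∉ X → x = y := by
      intro x y h1 h2 h3 h4
      by_contra h
      have := two_le_d h h1 h2 h3 h4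
      omega
    have m1 : fl h1 ∈ X := by
      by_contra hcon
      have m2 : fl h2 ∈ X := by
        by_contra h; exact n (hbd _ _ hh1 hcon hh2 h)
      have := hc _ hcl0 ⟨fl h2, by simp [m2, hf21]⟩ ⟨h1, by simp⟩
      have := d_eq_one (X := X \ {h1, h2}) (fl h2) (by simp [m2, hf21]) (by simp) (by
        intro x hx hx'
        simp only [Finset.mem_sdiff, Finset.mem_insert, Finset.mem_singleton] at hx hx'
        by_contra hne
        rw [← fl_eq] at hne
        by_cases e : fl x = h1
        · rw [fl_eq] at e; rw [e] at hx; exact hcon hx.1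
        · have : x = h1 := hbd x h1 hx.1 (by tauto) hh1 hcon
          tauto)
      omega
    have m2 : fl h2 ∈ X := by
      by_contra hcon
      have := hc _ hcl0 ⟨fl h1, by simp [m1, hfl]⟩ ⟨h1, by simp⟩
      have := d_eq_one (X := X \ {h1, h2}) (fl h1) (by simp [m1, hfl]) (by simp) (by
        intro x hx hx'
        simp only [Finset.mem_sdiff, Finset.mem_insert, Finset.mem_singleton] at hx hx'
        by_contra hne
        rw [← fl_eq] at hne
        by_cases e : fl x = h2
        · rw [fl_eq] at e; rw [e] at hx; exact hcon hx.1
        · have : x = h2 := hbd x h2 hx.1 (by tauto) hh2 hcon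
          tauto)
      omega
    refine ⟨X \ {h1, h2}, hcl0, ?_, ?_, ?_, ?_⟩
    · intro z hz hzX
      simp only [Finset.mem_sdiff, Finset.mem_insert, Finset.mem_singleton] at hzX
      exact hzX.2 (hcl z hz hzX.1)
    · simp [m1, hfl]
    · simp [m2, hf21]
    · rw [d_eq] at hd ⊢
      have : ((X \ {h1, h2}).filter fun x => fl x ∉ X \ {h1, h2}) ⊆
          (X.filter fun x => fl x ∉ X) ∪ {fl h1, fl h2} := by
        intro x
        simp only [Finset.mem_filter, Finset.mem_sdiff, Finset.mem_insert, Finset.mem_singleton,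
          Finset.mem_union, ← fl_eq]
        tauto
      have q1 := Finset.card_le_card this
      have q2 := Finset.card_union_le (X.filter fun x => fl x ∉ X) {fl h1, fl h2}
      have q3 := Finset.card_le_two (a := fl h1) (b := fl h2)
      omega
  unfold BL at hnc
  push Not at hnc
  obtain ⟨X, hX, hne, hne', hd⟩ := hnc
  by_cases h : h1 ∈ X
  · exact key X hX hne hne' (by omega) h
  · exact key Xᶜ hX.compl hne' (by rwa [compl_compl]) (by rw [d_compl]; omega) (by simpa using h)

structure Ctx (H : SimpleGraph V) (nd : HE V → ℕ) : Prop where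
  compat : Compat H nd
  bl : BL nd
  mx : ∀ nd', Compat H nd' → BL nd' → (img nd').card ≤ (img nd).card
  nt : ¬ Tr H
  big : 6 ≤ Fintype.card (HE V)

variable {H : SimpleGraph V} {nd : HE V → ℕ}

theorem Ctx.fib_le (c : Ctx H nd) (n : ℕ) : (fib nd n).card ≤ 3 := by
  classical
  by_contra hcon
  obtain ⟨f, hf⟩ := exists_fresh nd
  have hsplit : ∀ h1 h2, nd h1 = n → nd h2 = n → h1 ≠ h2 → fl h1 ≠ h2 →
      ∃ X, Closed nd X ∧ (∀ z, nd z = n → z ∉ X) ∧ fl h1 ∈ X ∧ fl h2 ∈ X ∧ d X ≤ 3 := by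
    intro h1 h2 e1 e2 n12 f12
    have h12 : nd h1 = nd h2 := by rw [e1, e2]
    have : ∃ h3 ∈ fib nd n, h3 ∉ ({h1, h2} : Finset (HE V)) := by
      apply Finset.exists_mem_notMem_of_card_lt_card
      have := Finset.card_le_two (a := h1) (b := h2)
      omega
    obtain ⟨h3, e3, n3⟩ := this
    simp at e3 n3
    have := split_bad c.bl hf h12 n12 f12 (fun h => by
      have := c.mx _ (sp_compat hf h12 c.compat) h
      have := sp_img (h3 := h3) hf h12 (by rw [e1, e3]) n3.1 n3.2
      omega)
    rwa [e1] at this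
  let Bad : Finset (HE V) → Prop := fun X =>
    Closed nd X ∧ (∀ z, nd z = n → z ∉ X) ∧ d X ≤ 3 ∧ ∃ h, nd h = n ∧ fl h ∈ X
  have hex : ∃ X, Bad X := by
    obtain ⟨h1, h2, h3, m1, m2, m3, n12, n13, n23, f12, f13⟩ := pick3 (fib nd n) (by omega)
    simp at m1 m2
    obtain ⟨X, h1', h2', h3', h4', h5'⟩ := hsplit h1 h2 m1 m2 n12 f12
    exact ⟨X, h1', h2', h5', h1, m1, h3'⟩
  obtain ⟨X, hXB, hmax⟩ := Finset.exists_max_image (Finset.univ.filter fun X => Bad X)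
    (fun X => X.card) (by obtain ⟨X, hX⟩ := hex; exact ⟨X, by simpa using hX⟩)
  simp only [Finset.mem_filter, Finset.mem_univ, true_and] at hXB hmax
  obtain ⟨hX, aX, dX, h1, e1, X1⟩ := hXB
  have h4 : ∃ h4, nd h4 = n ∧ fl h4 ∉ X := by
    by_contra hc
    push Not at hc
    have : (fib nd n).card ≤ d X := by
      rw [d_eq]
      apply Finset.card_le_card_of_injOn fl
      · intro z hz
        simp at hz ⊢
        exact ⟨hc z hz, aX z hz⟩
      · intro x _ y _ h; simpa using h
    omega
  obtain ⟨h4, e4, X4⟩ := h4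
  have n14 : h1 ≠ h4 := by rintro rfl; exact X4 X1
  have f14 : fl h1 ≠ h4 := by rintro rfl; exact aX _ e4 X1
  obtain ⟨Y, hY, aY, Y1, Y4, dY⟩ := hsplit h1 h4 e1 e4 n14 f14
  obtain ⟨pq, pr, po, qr, qo, ro, q1, q2, q3, q4, q5, q6, q7⟩ := uncross X Y
  have h1o : h1 ∉ X ∪ Y := by simp [aX _ e1, aY _ e1]
  have b1 : 2 ≤ d (X ∩ Y) := c.bl _ (hX.inter hY) ⟨fl h1, by simp [X1, Y1]⟩
    ⟨h1, by simp [aX _ e1]⟩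
  have b2 : 2 ≤ d (X \ Y) := by
    apply c.bl _ (hX.sdiff hY) _ ⟨h1, by simp [aX _ e1]⟩
    rw [Finset.sdiff_nonempty]
    intro hsub
    have := hmax Y ⟨hY, aY, dY, h1, e1, Y1⟩
    have := Finset.card_lt_card ((Finset.ssubset_iff_of_subset hsub).2 ⟨_, Y4, X4⟩)
    omega
  have b3 : 2 ≤ d (Y \ X) := c.bl _ (hY.sdiff hX) ⟨fl h4, by simp [X4, Y4]⟩
    ⟨h1, by simp [aY _ e1]⟩
  have b4 : 4 ≤ d (X ∪ Y) := by
    by_contra hc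
    have := hmax (X ∪ Y) ⟨hX.union hY, fun z hz => by simp [aX z hz, aY z hz], by omega,
      h1, e1, by simp [X1]⟩
    have := Finset.card_lt_card ((Finset.ssubset_iff_of_subset
      (Finset.subset_union_left (s₁ := X) (s₂ := Y))).2 ⟨_, Finset.mem_union_right X Y4, X4⟩)
    omega
  have b5 : 1 ≤ po := by
    rw [q7]
    unfold ee
    rw [Nat.succ_le_iff, Finset.card_pos]
    exact ⟨fl h1, by simp [X1, Y1, aX _ e1, aY _ e1]⟩
  omega

theorem Ctx.other (c : Ctx H nd) (x : HE V) : ∃ y, nd y = nd x ∧ y ≠ x := by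
  by_contra hcon
  push Not at hcon
  have h1 : Closed nd {x} := by
    intro a b h ha
    simp at ha ⊢; subst ha; exact hcon b h.symm
  have h2 := c.bl _ h1 ⟨x, by simp⟩ ⟨fl x, by simp⟩
  have h3 : d {x} = 1 := d_eq_one x (by simp) (by simp) (by simp)
  omega

theorem Ctx.two_le_fib (c : Ctx H nd) (x : HE V) : 2 ≤ (fib nd (nd x)).card := by
  obtain ⟨y, hy, hyx⟩ := c.other x
  have : ({y, x} : Finset (HE V)) ⊆ fib nd (nd x) := by
    intro z; simp; rintro (rfl | rfl) <;> simp [hy]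
  have := Finset.card_le_card this
  rwa [Finset.card_pair hyx] at this

theorem Ctx.noloop (c : Ctx H nd) (x : HE V) : nd (fl x) ≠ nd x := by
  intro h
  have hsub : ({x, fl x} : Finset (HE V)) ⊆ fib nd (nd x) := by
    intro z; simp; rintro (rfl | rfl) <;> simp [h]
  have hne : ((fib nd (nd x))ᶜ).Nonempty := by
    rw [← Finset.card_pos, Finset.card_compl]
    have := c.fib_le (nd x)
    have := c.big
    omega
  have h1 := c.bl _ (closed_fib nd (nd x)) ⟨x, by simp⟩ hne
  have h2 : d (fib nd (nd x)) ≤ (fib nd (nd x) \ {x, fl x}).card := by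
    rw [d_eq]
    apply Finset.card_le_card
    intro z
    simp only [Finset.mem_filter, mem_fib, Finset.mem_sdiff, Finset.mem_insert,
      Finset.mem_singleton]
    rintro ⟨hz, hz'⟩
    refine ⟨hz, ?_⟩
    rintro (rfl | rfl)
    · exact hz' h
    · simp at hz'
  rw [Finset.card_sdiff_of_subset hsub, Finset.card_pair (ne_fl x)] at h2
  have := c.fib_le (nd x)
  omega

/-- reattaching lemma -/
theorem reattach {nd : HE V → ℕ} {z g : HE V} (hz : Sg nd z) (hg : nd g = nd (fl z))
    (hgz : g ≠ fl z) {X : Finset (HE V)} (hX : Closed (Function.update nd g (nd z)) X)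
    (hne : X.Nonempty) (hne' : Xᶜ.Nonempty) (hd : d X ≤ 1) :
    ∃ Y, Closed nd Y ∧ Y.Nonempty ∧ Yᶜ.Nonempty ∧ d Y ≤ d X ∧ (z ∈ Y ↔ fl z ∈ Y) ∧
      ∀ x, x ≠ z → x ≠ g → (x ∈ Y ↔ x ∈ X) := by
  have hzf : nd (fl z) ≠ nd z := fun h => fl_ne z (hz _ h)
  have hgz' : g ≠ z := by rintro rfl; exact hzf hg.symm
  have ug : Function.update nd g (nd z) g = nd z := by simp
  have un : ∀ x, x ≠ g → Function.update nd g (nd z) x = nd x := by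
    intro x hx; simp [hx]
  have hgiff : ∀ X, Closed (Function.update nd g (nd z)) X → (g ∈ X ↔ z ∈ X) := fun X hX =>
    ⟨hX g z (by rw [ug, un z hgz'.symm]), hX z g (by rw [ug, un z hgz'.symm])⟩
  have hXn : ∀ X, Closed (Function.update nd g (nd z)) X →
      ∀ x y, x ≠ g → y ≠ g → nd x = nd y → x ∈ X → y ∈ X := fun X hX x y hx hy h hh =>
        hX x y (by rw [un x hx, un y hy, h]) hh
  have key : ∀ X, Closed (Function.update nd g (nd z)) X → X.Nonempty → Xᶜ.Nonempty → d X ≤ 1 →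
      z ∉ X → fl z ∈ X →
      ∃ Y, Closed nd Y ∧ Y.Nonempty ∧ Yᶜ.Nonempty ∧ d Y ≤ d X ∧ (z ∈ Y ↔ fl z ∈ Y) ∧
      ∀ x, x ≠ z → x ≠ g → (x ∈ Y ↔ x ∈ X) := by
    intro X hX hne hne' hd hzX hfz
    have hgX : g ∉ X := by rw [hgiff X hX]; exact hzX
    have hbd : ∀ x, x ∈ X → fl x ∉ X → x = fl z := by
      intro x h1 h2
      by_contra h
      have := two_le_d h h1 h2 hfz (by simpa using hzX)
      omega
    have hd1 : 1 ≤ d X := one_le_d hfz (by simpa using hzX)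
    have hfg : fl g ∉ X := fun h => hgz' (by simpa using hbd _ h (by simpa using hgX))
    have hfgz : fl g ≠ z := by rw [Ne, fl_eq]; exact hgz
    have hfgY : fl g ∉ X ∪ {z, g} := by simp [hfg, hfgz]
    refine ⟨X ∪ {z, g}, ?_, ⟨z, by simp⟩, ⟨fl g, by simpa using hfgY⟩, ?_, by simp [hfz], ?_⟩
    · intro x y hxy hx
      simp only [Finset.mem_union, Finset.mem_insert, Finset.mem_singleton] at hx ⊢
      by_cases ey : y = g
      · tauto
      by_cases ex : x = g
      · left
        exact hXn X hX (fl z) y hgz.symm ey (by rw [← hxy, ex, hg]) hfz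
      by_cases exz : x = z
      · right; left; rw [exz] at hxy; exact hz y hxy.symm
      · left
        exact hXn X hX x y ex ey hxy (by tauto)
    · rw [d_eq_one g (by simp) hfgY]
      · exact hd1
      · intro x hx hx'
        simp only [Finset.mem_union, Finset.mem_insert, Finset.mem_singleton] at hx hx'
        push Not at hx'
        rcases hx with hx | rfl | rfl
        · have := hbd x hx hx'.1
          rw [this] at hx'; simp at hx'
        · exact absurd hfz hx'.1
        · rfl
    · intro x h1 h2; simp [h1, h2]
  by_cases h1 : z ∈ X <;> by_cases h2 : fl z ∈ X
  · refine ⟨X, ?_, hne, hne', le_rfl, by tauto, by tauto⟩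
    intro x y hxy hx
    by_cases ey : y = g
    · rw [ey, hgiff X hX]; exact h1
    by_cases ex : x = g
    · exact hXn X hX (fl z) y hgz.symm ey (by rw [← hxy, ex, hg]) h2
    · exact hXn X hX x y ex ey hxy hx
  · obtain ⟨Y, a1, a2, a3, a4, a5, a6⟩ := key Xᶜ hX.compl hne' (by rwa [compl_compl])
      (by rwa [d_compl]) (by simpa using h1) (by simpa using h2)
    refine ⟨Yᶜ, a1.compl, a3, by rwa [compl_compl], by rw [d_compl, ← d_compl X]; exact a4,
      ?_, ?_⟩
    · rw [Finset.mem_compl, Finset.mem_compl, a5]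
    · intro x hx1 hx2
      have := a6 x hx1 hx2
      rw [Finset.mem_compl] at this ⊢
      tauto
  · exact key X hX hne hne' hd h1 h2
  · refine ⟨X, ?_, hne, hne', le_rfl, by tauto, by tauto⟩
    have hgX : g ∉ X := by rw [hgiff X hX]; exact h1
    intro x y hxy hx
    by_cases ex : x = g
    · rw [ex] at hx; exact absurd hx hgX
    by_cases ey : y = g
    · exact absurd (hXn X hX x (fl z) ex hgz.symm (by rw [hxy, ey, hg]) hx) h2
    · exact hXn X hX x y ex ey hxy hx

theorem recolor {nd : HE V → ℕ} (hbl : BL nd) {w g : HE V} {f : ℕ} (hf : ∀ x, nd x ≠ f)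
    (hg : nd g = nd w) (hgw : g ≠ w) {X : Finset (HE V)} (hX : Closed (Function.update nd w f) X)
    (hne : X.Nonempty) (hne' : Xᶜ.Nonempty) (hd : d X ≤ 1) :
    ∃ Y, Closed nd Y ∧ d Y ≤ d X + 1 ∧ (w ∈ Y ↔ w ∉ X) ∧ ∀ x, x ≠ w → (x ∈ Y ↔ x ∈ X) := by
  have un : ∀ x, x ≠ w → Function.update nd w f x = nd x := by
    intro x hx; simp [hx]
  have hXn : ∀ x y, x ≠ w → y ≠ w → nd x = nd y → x ∈ X → y ∈ X := fun x y hx hy h hh =>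
        hX x y (by rw [un x hx, un y hy, h]) hh
  have hnc : ¬ (g ∈ X ↔ w ∈ X) := by
    intro hiff
    have : Closed nd X := by
      intro x y hxy hx
      by_cases ey : y = w
      · rw [ey, ← hiff]
        by_cases ex : x = w
        · rw [hiff, ← ex]; exact hx
        · exact hXn x g ex hgw (by rw [hxy, ey, hg]) hx
      by_cases ex : x = w
      · exact hXn g y hgw ey (by rw [hg, ← hxy, ex]) (by rw [hiff, ← ex]; exact hx)
      · exact hXn x y ex ey hxy hx
    have := hbl X this hne hne'
    omega
  by_cases hw : w ∈ X
  · have hgX : g ∉ X := by tauto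
    refine ⟨X.erase w, ?_, ?_, by simp [hw], ?_⟩
    · intro x y hxy hx
      rw [Finset.mem_erase] at hx ⊢
      have ey : y ≠ w := by
        rintro rfl
        exact hgX (hXn x g hx.1 hgw (by rw [hxy, hg]) hx.2)
      exact ⟨ey, hXn x y hx.1 ey hxy hx.2⟩
    · rw [d_eq, d_eq]
      have : ((X.erase w).filter fun x => fl x ∉ X.erase w) ⊆
          (X.filter fun x => fl x ∉ X) ∪ {fl w} := by
        intro x
        simp only [Finset.mem_filter, Finset.mem_erase, Finset.mem_union, Finset.mem_singleton,
          ← fl_eq]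
        tauto
      have h1 := Finset.card_le_card this
      have h2 := Finset.card_union_le (X.filter fun x => fl x ∉ X) {fl w}
      rw [Finset.card_singleton] at h2
      omega
    · intro x hx; simp [hx]
  · have hgX : g ∈ X := by tauto
    refine ⟨insert w X, ?_, ?_, by simp [hw], ?_⟩
    · intro x y hxy hx
      rw [Finset.mem_insert] at hx ⊢
      by_cases ey : y = w
      · exact Or.inl ey
      right
      by_cases ex : x = w
      · exact hXn g y hgw ey (by rw [hg, ← hxy, ex]) hgX
      · exact hXn x y ex ey hxy (by tauto)
    · rw [d_eq, d_eq]
      have : ((insert w X).filter fun x => fl x ∉ insert w X) ⊆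
          (X.filter fun x => fl x ∉ X) ∪ {w} := by
        intro x
        simp only [Finset.mem_filter, Finset.mem_insert, Finset.mem_union, Finset.mem_singleton]
        tauto
      have h1 := Finset.card_le_card this
      have h2 := Finset.card_union_le (X.filter fun x => fl x ∉ X) {w}
      rw [Finset.card_singleton] at h2
      omega
    · intro x hx; simp [hx]

/-- conclusion extraction -/
theorem Ctx.extract (c : Ctx H nd) {nd' : HE V → ℕ} (hG : Compat H nd')
    (himg : (img nd).card < (img nd').card) (x y : HE V)
    (hY : ∀ X, Closed nd' X → X.Nonempty → Xᶜ.Nonempty → d X ≤ 1 →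
      ∃ Y, Closed nd Y ∧ d Y ≤ d X + 1 ∧ (x ∈ Y ↔ y ∉ Y)) :
    Conn nd' ∧ ∃ Y, Closed nd Y ∧ d Y = 2 ∧ x ∈ Y ∧ y ∉ Y := by
  have h2 : ∀ Y, Closed nd Y → (x ∈ Y ↔ y ∉ Y) → 2 ≤ d Y := by
    intro Y hY hxy
    by_cases h : x ∈ Y
    · exact c.bl Y hY ⟨x, h⟩ ⟨y, by simp; tauto⟩
    · exact c.bl Y hY ⟨y, by tauto⟩ ⟨x, by simpa using h⟩
  refine ⟨?_, ?_⟩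
  · intro X hX hne hne'
    by_contra hd
    obtain ⟨Y, y1, y2, y3⟩ := hY X hX hne hne' (by omega)
    have := h2 Y y1 y3
    omega
  · have : ¬ BL nd' := fun h => by
      have := c.mx nd' hG h
      omega
    unfold BL at this
    push Not at this
    obtain ⟨X, hX, hne, hne', hd⟩ := this
    obtain ⟨Y, y1, y2, y3⟩ := hY X hX hne hne' (by omega)
    have := h2 Y y1 y3
    by_cases h : x ∈ Y
    · exact ⟨Y, y1, by omega, h, by tauto⟩
    · exact ⟨Yᶜ, y1.compl, by rw [d_compl]; omega, by simpa using h, by simp; tauto⟩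

end
end CF

namespace CF

section
set_option linter.unusedSectionVars false
variable {V : Type*} [Fintype V] [DecidableEq V]
variable {H : SimpleGraph V} {nd : HE V → ℕ}

theorem odd_drop {nd nd' : HE V → ℕ} {a b : ℕ} (hab : a ≠ b) (ha : a ∈ oddN nd) (hb : b ∈ oddN nd)
    (h : ∀ m ∈ oddN nd', m ∈ oddN nd ∧ m ≠ a ∧ m ≠ b) :
    (oddN nd').card + 2 ≤ (oddN nd).card := by
  have h1 : oddN nd' ⊆ ((oddN nd).erase a).erase b := by
    intro m hm
    have := h m hm
    simp; tauto
  have h2 := Finset.card_le_card h1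
  rw [Finset.card_erase_of_mem (by simp [hab.symm, hb]), Finset.card_erase_of_mem ha] at h2
  have : ({a, b} : Finset ℕ) ⊆ oddN nd := by
    intro m; simp; rintro (rfl | rfl) <;> assumption
  have := Finset.card_le_card this
  rw [Finset.card_pair hab] at this
  omega

theorem Ctx.L2 (c : Ctx H nd) (x : HE V) : ∃ nd', Compat H nd' ∧ Conn nd' ∧
    (∃ Y, Closed nd Y ∧ d Y = 2 ∧ x ∈ Y ∧ fl x ∉ Y) ∧
    ((fib nd (nd x)).card = 3 → (fib nd (nd (fl x))).card = 3 →
      (oddN nd').card + 2 ≤ (oddN nd).card) := by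
  obtain ⟨g, hg, hgx⟩ := c.other (fl x)
  obtain ⟨g1, hg1, hg1x⟩ := c.other x
  obtain ⟨f, hf⟩ := exists_fresh nd
  have hl := c.noloop x
  have ngx : g ≠ x := by rintro rfl; exact hl hg.symm
  have ng1g : g1 ≠ g := by rintro rfl; exact hl (hg.symm.trans hg1)
  let nd1 := Function.update nd x f
  have u1x : nd1 x = f := by simp [nd1]
  have u1 : ∀ z, z ≠ x → nd1 z = nd z := by intro z hz; simp [nd1, hz]
  let nd' := Function.update nd1 g (nd1 x)
  have vx' : nd' x = f := by simp [nd', ngx.symm, u1x]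
  have vg : nd' g = f := by simp [nd', u1x]
  have v : ∀ z, z ≠ x → z ≠ g → nd' z = nd z := by
    intro z h1 h2; simp [nd', h2, u1 z h1]
  have vf : ∀ z, nd' z = f → z = x ∨ z = g := by
    intro z hz
    by_contra hcon
    push Not at hcon
    rw [v z hcon.1 hcon.2] at hz
    exact hf z hz
  have hG : Compat H nd' := by
    intro a b hab h
    by_cases ea : a = x ∨ a = g
    · have : nd' b = f := by rw [← h]; rcases ea with rfl | rfl <;> assumption
      rcases ea with rfl | rfl <;> rcases vf b this with rfl | rfl
      · exact absurd rfl hab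
      · simpa using c.compat (fl a) b (by simpa using hab) hg.symm
      · simpa using c.compat a (fl b) (by simpa using hab) hg
      · exact absurd rfl hab
    · by_cases eb : b = x ∨ b = g
      · exfalso
        apply ea; apply vf; rw [h]; rcases eb with rfl | rfl <;> assumption
      · push Not at ea eb
        rw [v a ea.1 ea.2, v b eb.1 eb.2] at h
        exact c.compat a b hab h
  have himg : (img nd).card < (img nd').card := by
    apply img_lt
    · intro y
      by_cases e1 : y = x
      · exact ⟨g1, by rw [v g1 hg1x ng1g, e1, hg1]⟩
      by_cases e2 : y = g
      · exact ⟨fl x, by rw [v (fl x) (fl_ne x) hgx.symm, e2, hg]⟩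
      exact ⟨y, v y e1 e2⟩
    · exact ⟨x, by rw [vx']; exact hf⟩
  have hsg : Sg nd1 x := by
    intro y hy
    by_contra hne
    rw [u1x, u1 y hne] at hy
    exact hf y hy
  obtain ⟨hC, hY⟩ := c.extract hG himg x (fl x) (by
    intro X hX hne hne' hd
    obtain ⟨Y1, a1, a2, a3, a4, a5, a6⟩ := reattach hsg
      (by rw [u1 g ngx, u1 (fl x) (fl_ne x), hg]) hgx hX hne hne' hd
    obtain ⟨Y, b1, b2, b3, b4⟩ := recolor c.bl hf hg1 hg1x a1 a2 a3 (by omega)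
    refine ⟨Y, b1, by omega, ?_⟩
    rw [b3, b4 _ (fl_ne x), a5])
  refine ⟨nd', hG, hC, hY, ?_⟩
  intro c1 c2
  apply odd_drop hl.symm
  · rw [mem_oddN, c1]; decide
  · rw [mem_oddN, c2]; decide
  · intro m hm
    rw [mem_oddN] at hm ⊢
    have hmf : m ≠ f := by
      rintro rfl
      have : fib nd' m = {x, g} := by
        ext z; simp
        exact ⟨vf z, by rintro (rfl | rfl) <;> assumption⟩
      rw [this, Finset.card_pair ngx.symm] at hm
      exact absurd hm (by decide)
    have h1 : m ≠ nd x := by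
      rintro rfl
      have : fib nd' (nd x) = (fib nd (nd x)).erase x := by
        ext z; simp
        by_cases e1 : z = x
        · simp [e1, vx']; exact (hmf).symm
        by_cases e2 : z = g
        · rw [e2, vg, hg]; simp [hl]; exact (hmf).symm
        · simp [v z e1 e2, e1]
      rw [this, Finset.card_erase_of_mem (by simp), c1] at hm
      exact absurd hm (by decide)
    have h2 : m ≠ nd (fl x) := by
      rintro rfl
      have : fib nd' (nd (fl x)) = (fib nd (nd (fl x))).erase g := by
        ext z; simp
        by_cases e1 : z = x
        · simp [e1, vx', hl.symm]; exact hmf.symm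
        by_cases e2 : z = g
        · rw [e2, vg, hg]; simp; exact hmf.symm
        · simp [v z e1 e2, e2]
      rw [this, Finset.card_erase_of_mem (by simp [hg]), c2] at hm
      exact absurd hm (by decide)
    refine ⟨?_, h1, h2⟩
    have : fib nd' m = fib nd m := by
      ext z; simp
      by_cases e1 : z = x
      · rw [e1, vx']; exact ⟨fun h => absurd h.symm hmf, fun h => absurd h.symm h1⟩
      by_cases e2 : z = g
      · rw [e2, vg]; exact ⟨fun h => absurd h.symm hmf, fun h => absurd (h.symm.trans hg) h2⟩
      rw [v z e1 e2]
    rwa [this] at hm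

set_option maxHeartbeats 4000000 in
theorem Ctx.L3 (c : Ctx H nd) (x y : HE V) (hy : nd y = nd (fl x)) (hyx : y ≠ fl x)
    (hcls : ∀ z, nd z = nd (fl x) → z = fl x ∨ z = y) (hac : nd x ≠ nd (fl y)) :
    ∃ nd', Compat H nd' ∧ Conn nd' ∧
    (∃ Y, Closed nd Y ∧ d Y = 2 ∧ x ∈ Y ∧ fl y ∉ Y) ∧
    ((fib nd (nd x)).card = 3 → (fib nd (nd (fl y))).card = 3 →
      (oddN nd').card + 2 ≤ (oddN nd).card) := by
  obtain ⟨g1, hg1, hg1x⟩ := c.other x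
  obtain ⟨g2, hg2, hg2y⟩ := c.other (fl y)
  obtain ⟨f, hf⟩ := exists_fresh nd
  have hlx := c.noloop x
  have hly := c.noloop y
  -- the four special half-edges are distinct
  have n1 : g1 ≠ fl x := by rintro rfl; exact hlx hg1
  have n2 : g1 ≠ y := by rintro rfl; exact hlx (hy.symm.trans hg1)
  have n3 : g1 ≠ g2 := by rintro rfl; exact hac (hg1.symm.trans hg2)
  have n4 : g2 ≠ fl x := by rintro rfl; exact hly (hg2.symm.trans hy.symm)
  have n5 : g2 ≠ y := by rintro rfl; exact hly hg2.symm
  have n6 : fl y ≠ fl x := by intro h; exact hly (by rw [h, hy])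
  have n7 : fl y ≠ g1 := by rintro rfl; exact hac hg1.symm
  let nd1 := Function.update nd (fl x) f
  have u1x : nd1 (fl x) = f := by simp [nd1]
  have u1 : ∀ z, z ≠ fl x → nd1 z = nd z := by intro z hz; simp [nd1, hz]
  let nd2 := Function.update nd1 g1 (nd1 (fl x))
  have u2x : nd2 (fl x) = f := by simp [nd2, n1.symm, u1x]
  have u2g : nd2 g1 = f := by simp [nd2, u1x]
  have u2 : ∀ z, z ≠ fl x → z ≠ g1 → nd2 z = nd z := by
    intro z h1 h2; simp [nd2, h2, u1 z h1]
  let nd' := Function.update nd2 g2 (nd2 y)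
  have vx' : nd' (fl x) = f := by simp [nd', n4.symm, u2x]
  have vg1 : nd' g1 = f := by simp [nd', n3, u2g]
  have vg2 : nd' g2 = nd y := by simp [nd', u2 y hyx n2.symm]
  have v : ∀ z, z ≠ fl x → z ≠ g1 → z ≠ g2 → nd' z = nd z := by
    intro z h1 h2 h3; simp [nd', h3, u2 z h1 h2]
  have vy : nd' y = nd y := v y hyx n2.symm n5.symm
  have vf : ∀ z, nd' z = f → z = fl x ∨ z = g1 := by
    intro z hz
    by_contra hcon
    push Not at hcon
    by_cases e : z = g2
    · rw [e, vg2] at hz; exact hf y hz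
    rw [v z hcon.1 hcon.2 e] at hz
    exact hf z hz
  have vny : ∀ z, nd' z = nd y → z = y ∨ z = g2 := by
    intro z hz
    by_contra hcon
    push Not at hcon
    by_cases e1 : z = fl x
    · rw [e1, vx'] at hz; exact hf y hz.symm
    by_cases e2 : z = g1
    · rw [e2, vg1] at hz; exact hf y hz.symm
    rw [v z e1 e2 hcon.2, hy] at hz
    have := hcls z hz
    tauto
  have hG : Compat H nd' := by
    intro a b hab h
    by_cases ea : nd' a = f
    · have eb : nd' b = f := by rw [← h, ea]
      rcases vf a ea with rfl | rfl <;> rcases vf b eb with rfl | rfl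
      · exact absurd rfl hab
      · simpa using c.compat x b (by simpa using hab) hg1.symm
      · simpa using c.compat a x (by simpa using hab) hg1
      · exact absurd rfl hab
    by_cases ea2 : nd' a = nd y
    · have eb : nd' b = nd y := by rw [← h, ea2]
      rcases vny a ea2 with rfl | rfl <;> rcases vny b eb with rfl | rfl
      · exact absurd rfl hab
      · simpa using c.compat (fl a) b (by simpa using hab) hg2.symm
      · simpa using c.compat a (fl b) (by simpa using hab) hg2
      · exact absurd rfl hab
    have eb : nd' b ≠ f := by rw [← h]; exact ea
    have eb2 : nd' b ≠ nd y := by rw [← h]; exact ea2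
    rw [v a (by rintro rfl; exact ea vx') (by rintro rfl; exact ea vg1)
      (by rintro rfl; exact ea2 vg2), v b (by rintro rfl; exact eb vx') (by rintro rfl; exact eb vg1)
      (by rintro rfl; exact eb2 vg2)] at h
    exact c.compat a b hab h
  have nxf : x ≠ fl x := ne_fl x
  have nxg2 : x ≠ g2 := by rintro rfl; exact hac hg2
  have himg : (img nd).card < (img nd').card := by
    apply img_lt
    · intro z
      by_cases e1 : z = fl x
      · exact ⟨y, by rw [vy, e1, hy]⟩
      by_cases e2 : z = g1
      · exact ⟨x, by rw [v x nxf hg1x.symm nxg2, e2, hg1]⟩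
      by_cases e3 : z = g2
      · exact ⟨fl y, by rw [v (fl y) n6 n7 hg2y.symm, e3, hg2]⟩
      exact ⟨z, v z e1 e2 e3⟩
    · exact ⟨fl x, by rw [vx']; exact hf⟩
  have hsg1 : Sg nd1 (fl x) := by
    intro z hz
    by_contra hne
    rw [u1x, u1 z hne] at hz
    exact hf z hz
  have hsg2 : Sg nd2 y := by
    intro z hz
    rw [u2 y hyx n2.symm] at hz
    by_contra hne
    by_cases e1 : z = fl x
    · rw [e1, u2x] at hz; exact hf y hz.symm
    by_cases e2 : z = g1
    · rw [e2, u2g] at hz; exact hf y hz.symm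
    rw [u2 z e1 e2, hy] at hz
    have := hcls z hz
    tauto
  obtain ⟨hC, hY⟩ := c.extract hG himg x (fl y) (by
    intro X hX hne hne' hd
    obtain ⟨Y2, p1, p2, p3, p4, p5, p6⟩ := reattach hsg2
      (by rw [u2 g2 n4 n3.symm, u2 (fl y) n6 n7, hg2]) hg2y hX hne hne' hd
    obtain ⟨Y1, a1, a2, a3, a4, a5, a6⟩ := reattach hsg1
      (by rw [fl_fl, u1 g1 n1, u1 x nxf, hg1]) (by rw [fl_fl]; exact hg1x) p1 p2 p3 (by omega)
    obtain ⟨Y, b1, b2, b3, b4⟩ := recolor c.bl hf hy hyx a1 a2 a3 (by omega)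
    refine ⟨Y, b1, by omega, ?_⟩
    have e1 : x ∈ Y ↔ fl x ∈ Y1 := by rw [b4 x nxf, a5, fl_fl]
    have e2 : fl x ∈ Y ↔ y ∈ Y := ⟨b1 _ _ hy.symm, b1 _ _ hy⟩
    have e3 : y ∈ Y ↔ y ∈ Y2 := by rw [b4 y hyx, a6 y hyx n2.symm]
    have e4 : fl y ∈ Y ↔ fl y ∈ Y2 := by rw [b4 _ n6, a6 _ n6 n7]
    tauto)
  refine ⟨nd', hG, hC, hY, ?_⟩
  intro c1 c2
  apply odd_drop hac
  · rw [mem_oddN, c1]; decide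
  · rw [mem_oddN, c2]; decide
  · intro m hm
    rw [mem_oddN] at hm ⊢
    have hmf : m ≠ f := by
      rintro rfl
      have : fib nd' m = {fl x, g1} := by
        ext z; simp
        exact ⟨vf z, by rintro (rfl | rfl) <;> assumption⟩
      rw [this, Finset.card_pair n1.symm] at hm
      exact absurd hm (by decide)
    have hmy : m ≠ nd y := by
      rintro rfl
      have : fib nd' (nd y) = {y, g2} := by
        ext z; simp
        exact ⟨vny z, by rintro (rfl | rfl) <;> assumption⟩
      rw [this, Finset.card_pair n5.symm] at hm
      exact absurd hm (by decide)
    have h1 : m ≠ nd x := by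
      rintro rfl
      have : fib nd' (nd x) = (fib nd (nd x)).erase g1 := by
        ext z; simp
        by_cases e1 : z = fl x
        · rw [e1, vx']; simp [hlx]; exact hmf.symm
        by_cases e2 : z = g1
        · rw [e2, vg1]; simp; exact hmf.symm
        by_cases e3 : z = g2
        · rw [e3, vg2, hg2]; simp [hmy.symm, hac.symm]
        · simp [v z e1 e2 e3, e2]
      rw [this, Finset.card_erase_of_mem (by simp [hg1]), c1] at hm
      exact absurd hm (by decide)
    have h2 : m ≠ nd (fl y) := by
      rintro rfl
      have : fib nd' (nd (fl y)) = (fib nd (nd (fl y))).erase g2 := by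
        ext z; simp
        by_cases e1 : z = fl x
        · rw [e1, vx', ← hy]; simp [hly.symm]; exact hmf.symm
        by_cases e2 : z = g1
        · rw [e2, vg1, hg1]; simp [hac]; exact hmf.symm
        by_cases e3 : z = g2
        · rw [e3, vg2]; simp [hly.symm]
        · simp [v z e1 e2 e3, e3]
      rw [this, Finset.card_erase_of_mem (by simp [hg2]), c2] at hm
      exact absurd hm (by decide)
    refine ⟨?_, h1, h2⟩
    have : fib nd' m = fib nd m := by
      ext z; simp
      by_cases e1 : z = fl x
      · rw [e1, vx', ← hy]; exact ⟨fun h => absurd h.symm hmf, fun h => absurd h.symm hmy⟩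
      by_cases e2 : z = g1
      · rw [e2, vg1, hg1]; exact ⟨fun h => absurd h.symm hmf, fun h => absurd h.symm h1⟩
      by_cases e3 : z = g2
      · rw [e3, vg2, hg2]; exact ⟨fun h => absurd h.symm hmy, fun h => absurd h.symm h2⟩
      rw [v z e1 e2 e3]
    rwa [this] at hm

end
end CF

namespace CF

/-! ### counting -/

section
set_option linter.unusedSectionVars false
variable {V : Type*} [Fintype V] [DecidableEq V]
variable {H : SimpleGraph V} {nd : HE V → ℕ}

def CC (nd : HE V → ℕ) : Finset (HE V) := Finset.univ.filter fun x => (fib nd (nd x)).card = 3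

theorem mem_CC {x : HE V} : x ∈ CC nd ↔ (fib nd (nd x)).card = 3 := by simp [CC]

theorem closed_CC : Closed nd (CC nd) := by
  intro x y h hx
  rw [mem_CC] at *
  rwa [← h]

theorem three_dvd {X : Finset (HE V)} (hX : Closed nd X) (h : X ⊆ CC nd) : X.card % 3 = 0 := by
  have : 3 ∣ X.card := by
    rw [card_closed hX]
    apply Finset.dvd_sum
    intro n hn
    obtain ⟨x, hx, rfl⟩ := Finset.mem_image.1 hn
    rw [mem_CC.1 (h hx)]
  omega

theorem Ctx.fib_eq_two (c : Ctx H nd) {x : HE V} (h : x ∉ CC nd) : (fib nd (nd x)).card = 2 := by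
  rw [mem_CC] at h
  have := c.fib_le (nd x)
  have := c.two_le_fib x
  omega

theorem Ctx.parity (c : Ctx H nd) {X : Finset (HE V)} (hX : Closed nd X) :
    (X ∩ CC nd).card % 2 = d X % 2 := by
  have h1 : 2 ∣ (X \ CC nd).card := by
    rw [card_closed (hX.sdiff closed_CC)]
    apply Finset.dvd_sum
    intro n hn
    obtain ⟨x, hx, rfl⟩ := Finset.mem_image.1 hn
    rw [c.fib_eq_two (Finset.mem_sdiff.1 hx).2]
  have h2 := Finset.card_inter_add_card_sdiff X (CC nd)
  have h3 := d_parity X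
  omega

theorem Ctx.card_CC (c : Ctx H nd) : (CC nd).card = 3 * (oddN nd).card := by
  rw [card_closed (nd := nd) closed_CC]
  have : (CC nd).image nd = oddN nd := by
    ext n
    rw [Finset.mem_image]
    constructor
    · rintro ⟨x, hx, rfl⟩
      rw [mem_oddN, mem_CC.1 hx]; decide
    · intro h
      rw [mem_oddN] at h
      have hp : 0 < (fib nd n).card := h.pos
      obtain ⟨x, hx⟩ := Finset.card_pos.1 hp
      rw [mem_fib] at hx
      subst hx
      refine ⟨x, ?_, rfl⟩
      by_contra hcon
      rw [c.fib_eq_two hcon] at h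
      exact absurd h (by decide)
  rw [this, Finset.sum_congr rfl (g := fun _ => 3), Finset.sum_const, smul_eq_mul, mul_comm]
  intro n hn
  rw [← this, Finset.mem_image] at hn
  obtain ⟨x, hx, rfl⟩ := hn
  exact mem_CC.1 hx

/-- partner function -/
def Pt (nd : HE V → ℕ) (pt : HE V → HE V) : Prop :=
  ∀ x, x ∉ CC nd → nd (pt x) = nd x ∧ pt x ≠ x ∧ ∀ z, nd z = nd x → z = x ∨ z = pt x

theorem Ctx.exists_pt (c : Ctx H nd) : ∃ pt, Pt nd pt := by
  have : ∀ x, ∃ y, x ∉ CC nd → nd y = nd x ∧ y ≠ x ∧ ∀ z, nd z = nd x → z = x ∨ z = y := by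
    intro x
    obtain ⟨y, h1, h2⟩ := c.other x
    refine ⟨y, fun hx => ⟨h1, h2, ?_⟩⟩
    intro z hz
    by_contra hcon
    push Not at hcon
    have h3 : ({x, y, z} : Finset (HE V)) ⊆ fib nd (nd x) := by
      intro w hw
      simp at hw ⊢
      rcases hw with rfl | rfl | rfl
      · rfl
      · exact h1
      · exact hz
    have h4 := Finset.card_le_card h3
    rw [c.fib_eq_two hx, Finset.card_eq_three.2 ⟨x, y, z, h2.symm, hcon.1.symm, hcon.2.symm, rfl⟩] at h4
    omega
  choose pt h using this
  exact ⟨pt, h⟩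

def Cheap (H : SimpleGraph V) (nd : HE V → ℕ) (x z : HE V) : Prop :=
  x ∈ CC nd ∧ z ∈ CC nd ∧ (∃ nd', Compat H nd' ∧ Conn nd' ∧ (oddN nd').card + 2 ≤ (oddN nd).card) ∧
    ∃ Y, Closed nd Y ∧ d Y = 2 ∧ x ∈ Y ∧ z ∉ Y

theorem Ctx.cheap1 (c : Ctx H nd) {x : HE V} (h : x ∈ CC nd) (h' : fl x ∈ CC nd) :
    Cheap H nd x (fl x) := by
  obtain ⟨nd', a, b, e, f⟩ := c.L2 x
  exact ⟨h, h', ⟨nd', a, b, f (mem_CC.1 h) (mem_CC.1 h')⟩, e⟩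

theorem Ctx.cheap2 (c : Ctx H nd) {pt : HE V → HE V} (hp : Pt nd pt) {x : HE V} (h : x ∈ CC nd)
    (h1 : fl x ∉ CC nd) (h2 : fl (pt (fl x)) ∈ CC nd) : Cheap H nd x (fl (pt (fl x))) := by
  obtain ⟨q1, q2, q3⟩ := hp _ h1
  have hac : nd x ≠ nd (fl (pt (fl x))) := by
    intro hac
    set y := pt (fl x)
    have hcX : Closed nd (fib nd (nd x) ∪ fib nd (nd (fl x))) :=
      (closed_fib nd _).union (closed_fib nd _)
    have hdis : Disjoint (fib nd (nd x)) (fib nd (nd (fl x))) := by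
      rw [Finset.disjoint_left]
      intro a ha hb
      rw [mem_fib] at ha hb
      exact c.noloop x (hb.symm.trans ha)
    have hcard : (fib nd (nd x) ∪ fib nd (nd (fl x))).card = 5 := by
      rw [Finset.card_union_of_disjoint hdis, mem_CC.1 h, c.fib_eq_two h1]
    have hne' : (fib nd (nd x) ∪ fib nd (nd (fl x)))ᶜ.Nonempty := by
      rw [← Finset.card_pos, Finset.card_compl, hcard]
      have := c.big
      omega
    have hd := c.bl _ hcX ⟨x, by simp⟩ hne'
    have hpar := d_parity (fib nd (nd x) ∪ fib nd (nd (fl x)))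
    rw [hcard] at hpar
    have hle : d (fib nd (nd x) ∪ fib nd (nd (fl x))) ≤ 1 := by
      rw [d_eq]
      have hsub : ((fib nd (nd x) ∪ fib nd (nd (fl x))).filter
          fun a => fl a ∉ fib nd (nd x) ∪ fib nd (nd (fl x))) ⊆ ((fib nd (nd x)).erase x).erase (fl y) := by
        intro a ha
        rw [Finset.mem_filter, Finset.mem_union, Finset.mem_union, mem_fib, mem_fib, mem_fib, mem_fib] at ha
        push Not at ha
        obtain ⟨ha1, ha2, ha3⟩ := ha
        have hax : a ≠ x := by rintro rfl; exact ha3 rfl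
        have hay : a ≠ fl y := by rintro rfl; rw [fl_fl] at ha3; exact ha3 q1
        rw [Finset.mem_erase, Finset.mem_erase, mem_fib]
        refine ⟨hay, hax, ?_⟩
        rcases ha1 with h | h
        · exact h
        rcases q3 a h with rfl | rfl
        · exfalso; apply ha2; rw [fl_fl]
        · exact absurd hac.symm ha2
      have := Finset.card_le_card hsub
      rw [Finset.card_erase_of_mem, Finset.card_erase_of_mem, mem_CC.1 h] at this
      · omega
      · simp
      · rw [Finset.mem_erase, mem_fib]
        refine ⟨?_, hac.symm⟩
        intro e; rw [fl_eq] at e; exact q2 e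
    omega
  obtain ⟨nd', a, b, e, f⟩ := c.L3 x (pt (fl x)) q1 q2 q3 hac
  exact ⟨h, h2, ⟨nd', a, b, f (mem_CC.1 h) (mem_CC.1 h2)⟩, e⟩

theorem fine_count {pt : HE V → HE V} (hp : Pt nd pt) {S T : Finset (HE V)} (hS : S ⊆ CC nd)
    (hST : S ⊆ T) (h1 : ∀ x ∈ S, fl x ∉ CC nd ∧ fl x ∈ T)
    (h2 : ∀ x ∈ S, fl (pt (fl x)) ∉ CC nd ∧ pt (fl x) ∈ T) : 3 * S.card ≤ T.card := by
  have hn : ∀ x ∈ S, pt (fl x) ∉ CC nd := fun x hx hc =>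
    (h1 x hx).1 (closed_CC _ _ (hp _ (h1 x hx).1).1 hc)
  have i1 : (S.image fl).card = S.card :=
    Finset.card_image_of_injective _ (fun a b h => fl_inj.1 h)
  have i2 : (S.image fun x => pt (fl x)).card = S.card := by
    apply Finset.card_image_of_injOn
    intro a ha b hb hab
    simp only at hab
    obtain ⟨p1, p2, p3⟩ := hp _ (h1 a ha).1
    obtain ⟨q1, q2, q3⟩ := hp _ (h1 b hb).1
    rcases p3 (fl b) (by rw [← q1, ← p1, hab]) with h | h
    · exact (fl_inj.1 h).symm
    · exact absurd (h.trans hab).symm q2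
  have d1 : Disjoint S (S.image fl) := by
    rw [Finset.disjoint_left]
    intro a ha hb
    obtain ⟨b, hb2, rfl⟩ := Finset.mem_image.1 hb
    exact (h1 b hb2).1 (hS ha)
  have d2 : Disjoint (S ∪ S.image fl) (S.image fun x => pt (fl x)) := by
    rw [Finset.disjoint_left]
    intro a ha hb
    obtain ⟨b, hb2, rfl⟩ := Finset.mem_image.1 hb
    rcases Finset.mem_union.1 ha with ha | ha
    · exact hn b hb2 (hS ha)
    · obtain ⟨e, he, hee⟩ := Finset.mem_image.1 ha
      apply (h2 b hb2).1
      rw [← hee, fl_fl]; exact hS he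
  have : (S ∪ S.image fl) ∪ (S.image fun x => pt (fl x)) ⊆ T := by
    intro a ha
    simp only [Finset.mem_union, Finset.mem_image] at ha
    rcases ha with (ha | ⟨b, hb, rfl⟩) | ⟨b, hb, rfl⟩
    · exact hST ha
    · exact (h1 b hb).2
    · exact (h2 b hb).2
  have := Finset.card_le_card this
  rw [Finset.card_union_of_disjoint d2, Finset.card_union_of_disjoint d1, i1, i2] at this
  omega

def PP (nd : HE V → ℕ) (X : Finset (HE V)) : Prop :=
  Closed nd X ∧ d X = 2 ∧ (X ∩ CC nd).Nonempty ∧ (Xᶜ ∩ CC nd).Nonempty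

theorem Ctx.union_two (c : Ctx H nd) {X Y : Finset (HE V)} (hX : Closed nd X) (hY : Closed nd Y)
    (dX : d X = 2) (dY : d Y = 2) (h : (X ∩ Y).Nonempty) (h' : (X ∪ Y)ᶜ.Nonempty) :
    d (X ∩ Y) = 2 ∧ d (X ∪ Y) = 2 := by
  have h1 := c.bl _ (hX.inter hY) h (h'.mono (by intro a; simp; tauto))
  have h2 := c.bl _ (hX.union hY) (h.mono (by intro a; simp; tauto)) h'
  obtain ⟨pq, pr, po, qr, qo, ro, e1, e2, e3, e4, e5, e6, -⟩ := uncross X Y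
  omega

theorem Ctx.no_cheap (c : Ctx H nd) {X : Finset (HE V)} (hX : Minimal (PP nd) X) {x z : HE V}
    (hx : x ∈ X) (hz : z ∈ X) (h : Cheap H nd x z) : False := by
  obtain ⟨hxC, hzC, -, Y, hY, dY, hxY, hzY⟩ := h
  obtain ⟨⟨cX, dX, -, ⟨w, hw⟩⟩, hmin⟩ := hX
  rw [Finset.mem_inter, Finset.mem_compl] at hw
  by_cases hu : (X ∪ Y)ᶜ.Nonempty
  · obtain ⟨h1, h2⟩ := c.union_two cX hY dX dY ⟨x, by simp [hx, hxY]⟩ hu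
    have := hmin (y := X ∩ Y) ⟨cX.inter hY, h1, ⟨x, by simp [hx, hxY, hxC]⟩,
      ⟨z, by simp [hzY, hzC]⟩⟩ Finset.inter_subset_left
    exact hzY (Finset.mem_inter.1 (this hz)).2
  · have hsub : Yᶜ ≤ X := by
      intro a ha
      by_contra hcon
      apply hu
      refine ⟨a, ?_⟩
      simp at ha ⊢
      exact ⟨hcon, ha⟩
    have := hmin (y := Yᶜ) ⟨hY.compl, by rw [d_compl, dY], ⟨z, by simp [hzY, hzC]⟩,
      ⟨x, by simp [hxY, hxC]⟩⟩ hsub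
    have := this hx
    simp at this
    exact this hxY

theorem Ctx.min_count (c : Ctx H nd) {X : Finset (HE V)} (hX : Minimal (PP nd) X) :
    3 * (X ∩ CC nd).card ≤ (X.filter fun x => fl x ∈ X).card + 6 := by
  obtain ⟨pt, hp⟩ := c.exists_pt
  have nc := fun {x z : HE V} => c.no_cheap hX (x := x) (z := z)
  obtain ⟨cX, dX, -, -⟩ := hX.1
  have k1 : ∀ x ∈ X ∩ CC nd, fl x ∈ X → fl x ∉ CC nd ∧ pt (fl x) ∈ X := by
    intro x hx hfx
    rw [Finset.mem_inter] at hx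
    have : fl x ∉ CC nd := fun h => nc hx.1 hfx (c.cheap1 hx.2 h)
    exact ⟨this, cX _ _ (hp _ this).1.symm hfx⟩
  let S := (X ∩ CC nd).filter fun x => fl x ∈ X ∧ fl (pt (fl x)) ∈ X
  let N := (X ∩ CC nd).filter fun x => ¬ (fl x ∈ X ∧ fl (pt (fl x)) ∈ X)
  have hsum : S.card + N.card = (X ∩ CC nd).card := Finset.card_filter_add_card_filter_not _
  have hN : N.card ≤ 2 := by
    rw [← dX, d_eq]
    apply Finset.card_le_card_of_injOn (fun x => if fl x ∈ X then pt (fl x) else x)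
    · intro x hx
      have hx := Finset.mem_filter.1 (Finset.mem_coe.1 hx)
      simp only
      rw [Finset.mem_coe, Finset.mem_filter]
      split_ifs with h
      · exact ⟨(k1 x hx.1 h).2, fun h' => hx.2 ⟨h, h'⟩⟩
      · exact ⟨(Finset.mem_inter.1 hx.1).1, h⟩
    · have hn : ∀ x ∈ X ∩ CC nd, fl x ∈ X → pt (fl x) ∉ CC nd := fun x hx h hc =>
        (k1 x hx h).1 (closed_CC _ _ (hp _ (k1 x hx h).1).1 hc)
      intro a ha b hb hab
      have ha := (Finset.mem_filter.1 (Finset.mem_coe.1 ha)).1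
      have hb := (Finset.mem_filter.1 (Finset.mem_coe.1 hb)).1
      simp only at hab
      split_ifs at hab with h1 h2 h2
      · obtain ⟨p1, p2, p3⟩ := hp _ (k1 a ha h1).1
        obtain ⟨q1, q2, q3⟩ := hp _ (k1 b hb h2).1
        rcases p3 (fl b) (by rw [← q1, ← p1, hab]) with h | h
        · exact (fl_inj.1 h).symm
        · exact absurd (h.trans hab).symm q2
      · exact absurd (hab ▸ (Finset.mem_inter.1 hb).2) (hn a ha h1)
      · exact absurd (hab ▸ (Finset.mem_inter.1 ha).2) (hn b hb h2)
      · exact hab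
  have hS : 3 * S.card ≤ (X.filter fun x => fl x ∈ X).card := by
    apply fine_count hp
    · exact (Finset.filter_subset _ _).trans Finset.inter_subset_right
    · intro x hx
      obtain ⟨h1, h2, h3⟩ := Finset.mem_filter.1 hx
      rw [Finset.mem_filter]
      exact ⟨(Finset.mem_inter.1 h1).1, h2⟩
    · intro x hx
      obtain ⟨h1, h2, h3⟩ := Finset.mem_filter.1 hx
      rw [Finset.mem_filter, fl_fl]
      exact ⟨(k1 x h1 h2).1, h2, (Finset.mem_inter.1 h1).1⟩
    · intro x hx
      obtain ⟨h1, h2, h3⟩ := Finset.mem_filter.1 hx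
      rw [Finset.mem_filter]
      refine ⟨fun h => ?_, (k1 x h1 h2).2, h3⟩
      exact nc (Finset.mem_inter.1 h1).1 h3 (c.cheap2 hp (Finset.mem_inter.1 h1).2 (k1 x h1 h2).1 h)
  omega

theorem Ctx.absorb_min (c : Ctx H nd) {X Y : Finset (HE V)} (hX : Closed nd X) (dX : d X = 2)
    (hY : Closed nd Y) (dY : d Y = 2) {z : HE V} (h1 : z ∉ X) (h2 : z ∉ Y) :
    ∃ Z, Closed nd Z ∧ d Z = 2 ∧ (∀ a, a ∉ X → (a ∈ Z ↔ a ∈ Y)) ∧ (X ⊆ Z ∨ Disjoint X Z) := by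
  by_cases h : (X ∩ Y).Nonempty
  · refine ⟨X ∪ Y, hX.union hY, (c.union_two hX hY dX dY h ⟨z, by simp [h1, h2]⟩).2, ?_, ?_⟩
    · intro a ha; simp [ha]
    · left; exact Finset.subset_union_left
  · refine ⟨Y, hY, dY, fun a _ => Iff.rfl, Or.inr ?_⟩
    rw [Finset.not_nonempty_iff_eq_empty] at h
    exact Finset.disjoint_iff_inter_eq_empty.2 h

theorem Ctx.count (c : Ctx H nd) (hV : Fintype.card (HE V) ≤ 34) : False := by
  have hconn : Conn nd := fun X h1 h2 h3 => le_trans (by norm_num) (c.bl X h1 h2 h3)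
  have ho3 : 3 ≤ (oddN nd).card := by
    by_contra h
    exact c.nt (euler c.compat hconn (by omega))
  have hC := c.card_CC
  have hCe := c.parity (X := Finset.univ) (fun _ _ _ _ => Finset.mem_univ _)
  rw [Finset.univ_inter, d_eq_zero (fun x _ => Finset.mem_univ _)] at hCe
  have hex : ∃ x z, Cheap H nd x z := by
    by_contra hno
    push Not at hno
    obtain ⟨pt, hp⟩ := c.exists_pt
    have g1 : ∀ x ∈ CC nd, fl x ∉ CC nd := fun x hx h => hno _ _ (c.cheap1 hx h)
    have := fine_count hp (S := CC nd) (T := Finset.univ) (fun _ h => h) (Finset.subset_univ _)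
      (fun x hx => ⟨g1 x hx, Finset.mem_univ _⟩)
      (fun x hx => ⟨fun h => hno _ _ (c.cheap2 hp hx (g1 x hx) h), Finset.mem_univ _⟩)
    rw [Finset.card_univ] at this
    omega
  obtain ⟨x0, z0, hx0, hz0, ⟨nd', k1, k2, k3⟩, Y0, cY0, dY0, hxY0, hzY0⟩ := hex
  have ho5 : 5 ≤ (oddN nd).card := by
    by_contra h
    exact c.nt (euler k1 k2 (by omega))
  obtain ⟨X1, s1, m1⟩ := exists_minimal_le_of_wellFoundedLT (PP nd) Y0
    ⟨cY0, dY0, ⟨x0, by simp [*]⟩, ⟨z0, by simp [*]⟩⟩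
  obtain ⟨X2, s2, m2⟩ := exists_minimal_le_of_wellFoundedLT (PP nd) Y0ᶜ
    ⟨cY0.compl, by rw [d_compl, dY0], ⟨z0, by simp [*]⟩, ⟨x0, by simp [*]⟩⟩
  have hdis : Disjoint X1 X2 := by
    rw [Finset.disjoint_left]
    intro a h1 h2
    exact Finset.mem_compl.1 (s2 h2) (s1 h1)
  have t1 := c.min_count m1
  have t2 := c.min_count m2
  obtain ⟨⟨cX1, dX1, n1, -⟩, -⟩ := m1
  obtain ⟨⟨cX2, dX2, n2, -⟩, -⟩ := m2
  have p1 := c.parity cX1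
  have p2 := c.parity cX2
  have q1 := three_dvd (cX1.inter closed_CC) Finset.inter_subset_right
  have q2 := three_dvd (cX2.inter closed_CC) Finset.inter_subset_right
  rw [← Finset.card_pos] at n1 n2
  let R := CC nd \ (X1 ∪ X2)
  have cR : Closed nd R := closed_CC.sdiff (cX1.union cX2)
  have mR : ∀ {a}, a ∈ R ↔ a ∈ CC nd ∧ a ∉ X1 ∧ a ∉ X2 := by
    intro a; simp [R]
  have hTT : Disjoint (X1.filter fun x => fl x ∈ X1) (X2.filter fun x => fl x ∈ X2) :=
    Finset.disjoint_filter_filter hdis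
  have hRT : Disjoint (R ∪ R.image fl)
      ((X1.filter fun x => fl x ∈ X1) ∪ (X2.filter fun x => fl x ∈ X2)) := by
    rw [Finset.disjoint_left]
    intro a ha hb
    simp only [Finset.mem_union, Finset.mem_image, Finset.mem_filter] at ha hb
    rcases ha with ha | ⟨b, hb', rfl⟩
    · rw [mR] at ha; tauto
    · rw [mR] at hb'; rw [fl_fl] at hb; tauto
  have htot := Finset.card_le_univ ((R ∪ R.image fl) ∪
      ((X1.filter fun x => fl x ∈ X1) ∪ (X2.filter fun x => fl x ∈ X2)))
  rw [Finset.card_union_of_disjoint hRT, Finset.card_union_of_disjoint hTT] at htot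
  have hRC : ∀ Z : Finset (HE V), (Z ∩ CC nd).card =
      (R ∩ Z).card + (X1 ∩ CC nd ∩ Z).card + (X2 ∩ CC nd ∩ Z).card := by
    intro Z
    rw [← Finset.card_union_of_disjoint, ← Finset.card_union_of_disjoint]
    · congr 1
      ext a
      simp only [Finset.mem_union, Finset.mem_inter, mR]
      tauto
    · rw [Finset.disjoint_left]
      intro a ha hb
      simp only [Finset.mem_union, Finset.mem_inter, mR] at ha hb
      have : a ∈ X1 → a ∉ X2 := fun h => Finset.disjoint_left.1 hdis h
      tauto
    · rw [Finset.disjoint_left]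
      intro a ha hb
      simp only [Finset.mem_union, Finset.mem_inter, mR] at ha hb
      tauto
  have hR0 := hRC Finset.univ
  simp only [Finset.univ_inter, Finset.inter_univ] at hR0
  have hRle : R.card ≤ (R ∪ R.image fl).card := Finset.card_le_card Finset.subset_union_left
  have hRx : ∃ x ∈ R, fl x ∈ R := by
    by_contra hno
    push Not at hno
    have hd : Disjoint R (R.image fl) := by
      rw [Finset.disjoint_left]
      intro a ha hb
      obtain ⟨b, hb2, rfl⟩ := Finset.mem_image.1 hb
      exact hno b hb2 ha
    rw [Finset.card_union_of_disjoint hd,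
      Finset.card_image_of_injective _ (fun a b h => fl_inj.1 h)] at htot
    omega
  obtain ⟨x, hx, hfx⟩ := hRx
  have hR6 : R.card = 6 := by omega
  have h61 : (X1 ∩ CC nd).card = 6 := by omega
  have h62 : (X2 ∩ CC nd).card = 6 := by omega
  obtain ⟨-, -, -, Y, cY, dY, hxY, hfY⟩ := c.cheap1 (mR.1 hx).1 (mR.1 hfx).1
  have hfx' := mR.1 hfx
  have hx' := mR.1 hx
  obtain ⟨Z1, cZ1, dZ1, e1, f1⟩ := c.absorb_min cX1 dX1 cY dY hfx'.2.1 hfY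
  have hfZ1 : fl x ∉ Z1 := fun h => hfY ((e1 _ hfx'.2.1).1 h)
  obtain ⟨Z, cZ, dZ, e2, f2⟩ := c.absorb_min cX2 dX2 cZ1 dZ1 hfx'.2.2 hfZ1
  have hfZ : fl x ∉ Z := fun h => hfZ1 ((e2 _ hfx'.2.2).1 h)
  have hxZ : x ∈ Z := (e2 _ hx'.2.2).2 ((e1 _ hx'.2.1).2 hxY)
  have f1' : X1 ⊆ Z ∨ Disjoint X1 Z := by
    rcases f1 with f1 | f1
    · left; intro a ha
      exact (e2 _ (Finset.disjoint_left.1 hdis ha)).2 (f1 ha)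
    · right; rw [Finset.disjoint_left] at *
      intro a ha h
      exact f1 ha ((e2 _ (hdis ha)).1 h)
  have aux : ∀ X : Finset (HE V), (X ∩ CC nd).card = 6 → (X ⊆ Z ∨ Disjoint X Z) →
      (X ∩ CC nd ∩ Z).card = 6 ∨ (X ∩ CC nd ∩ Z).card = 0 := by
    intro X h6 h
    rcases h with h | h
    · left
      rw [Finset.inter_eq_left.2 (Finset.inter_subset_left.trans h), h6]
    · right
      rw [Finset.card_eq_zero, ← Finset.disjoint_iff_inter_eq_empty]
      exact h.mono_left Finset.inter_subset_left
  have a1 := aux X1 h61 f1'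
  have a2 := aux X2 h62 f2
  have hRZ : (R ∩ Z).card = 3 := by
    have u1 : fib nd (nd x) ⊆ R ∩ Z := by
      intro a ha
      rw [mem_fib] at ha
      exact Finset.mem_inter.2 ⟨cR _ _ ha.symm hx, cZ _ _ ha.symm hxZ⟩
    have u2 : fib nd (nd (fl x)) ⊆ R \ Z := by
      intro a ha
      rw [mem_fib] at ha
      exact Finset.mem_sdiff.2 ⟨cR _ _ ha.symm hfx, fun h => hfZ (cZ _ _ ha h)⟩
    have v1 := Finset.card_le_card u1
    have v2 := Finset.card_le_card u2
    rw [mem_CC.1 hx'.1] at v1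
    rw [mem_CC.1 hfx'.1] at v2
    have := Finset.card_inter_add_card_sdiff R Z
    omega
  have := hRC Z
  have := c.parity cZ
  omega

end
end CF

theorem stmt_18 {V : Type*} [Fintype V] (G : SimpleGraph V)
    (h3 : 3 ≤ Fintype.card V) (hconn : G.Connected)
    (hcut : ∀ v : V, (G.induce ({v}ᶜ : Set V)).Connected)
    (hclaw : ∀ v a b c : V, G.Adj v a → G.Adj v b → G.Adj v c →
      a ≠ b → a ≠ c → b ≠ c → G.Adj a b ∨ G.Adj a c ∨ G.Adj b c)
    (hnt : ¬ Traceable G) :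
    18 ≤ Fintype.card V := by
  classical
  have hTr : ¬ CF.Tr G := by
    rintro ⟨l, h1, h2, hch⟩
    apply hnt
    have hne : l ≠ [] := by
      rintro rfl
      obtain ⟨v⟩ := hconn.nonempty
      simpa using h2 v
    refine ⟨_, _, SimpleGraph.Walk.ofSupport l hne hch, ?_, ?_⟩
    · rw [SimpleGraph.Walk.isPath_def, SimpleGraph.Walk.support_ofSupport]; exact h1
    · rw [SimpleGraph.Walk.support_ofSupport]; exact h2
  obtain ⟨H, hGH, hcf, hnH, hd⟩ := CF.closure G hclaw hTr
  have hcon : ∀ S : Set V, S.Nonempty → Sᶜ.Nonempty → ∃ a ∈ S, ∃ b ∉ S, H.Adj a b := by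
    rintro S ⟨a, ha⟩ ⟨b, hb⟩
    obtain ⟨p⟩ := hconn.preconnected a b
    obtain ⟨e, -, h1, h2⟩ := p.exists_boundary_dart S ha hb
    exact ⟨_, h1, _, h2, hGH e.adj⟩
  have hcut' : ∀ v, ∀ S : Set V, v ∉ S → S.Nonempty → (∃ w, w ∉ S ∧ w ≠ v) →
      ∃ a ∈ S, ∃ b ∉ S, b ≠ v ∧ H.Adj a b := by
    rintro v S hv ⟨a, ha⟩ ⟨w, hw, hwv⟩
    have hav : a ≠ v := by rintro rfl; exact hv ha
    obtain ⟨p⟩ := (hcut v).preconnected ⟨a, hav⟩ ⟨w, hwv⟩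
    obtain ⟨e, -, h1, h2⟩ := p.exists_boundary_dart (Subtype.val ⁻¹' S) ha hw
    exact ⟨_, h1, _, h2, e.snd.2, hGH e.adj⟩
  have hnb : ∀ v, ∃ w, H.Adj v w := by
    intro v
    have : Nontrivial V := Fintype.one_lt_card_iff_nontrivial.1 (by omega)
    obtain ⟨w, hw⟩ := exists_ne v
    obtain ⟨a, ha, b, -, hab⟩ := hcon {v} ⟨v, rfl⟩ ⟨w, hw⟩
    rw [Set.mem_singleton_iff] at ha
    subst ha
    exact ⟨b, hab⟩
  obtain ⟨nd, k1, k2⟩ := CF.nd0 H hcf hd hnb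
  obtain ⟨nd, ⟨m1, m2⟩, m3⟩ := CF.exists_max (fun nd => CF.Compat H nd ∧ CF.BL nd)
    (CF.absorb hnH k1 (CF.nd0_AB H hcon hcut' k2))
  by_contra hlt
  have hc : CF.Ctx H nd := ⟨m1, m2, fun nd' a b => m3 nd' ⟨a, b⟩, hnH, by rw [CF.card_HE]; omega⟩
  exact hc.count (by rw [CF.card_HE]; omega)
end

section
/- Let G be a maximal nontraceable (MNT) finite simple graph: G has no hamiltonian path, but G + e has a hamiltonian path for every edge e of the complement of G. If v is a vertex of G of degree two with neighbours x and y, then x and y are adjacent in G. -/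
open SimpleGraph

theorem trace_of_list {V : Type*} (G : SimpleGraph V) : ∀ (l : List V) (a : V),
    (a :: l).IsChain G.Adj → ∃ (w : V) (p : G.Walk a w), p.support = a :: l := by
  intro l
  induction l with
  | nil => intro a _; exact ⟨a, Walk.nil, rfl⟩
  | cons b l ih =>
    intro a h
    rw [List.isChain_cons_cons] at h
    obtain ⟨w, p, hp⟩ := ih b h.2
    exact ⟨w, Walk.cons h.1 p, by simp [hp]⟩

theorem traceable_of_list {V : Type*} (G : SimpleGraph V) (l : List V) (h0 : l ≠ [])
    (hc : l.IsChain G.Adj) (hn : l.Nodup) (ha : ∀ z, z ∈ l) : Traceable G := by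
  cases l with
  | nil => exact absurd rfl h0
  | cons a l =>
    obtain ⟨w, p, hp⟩ := trace_of_list G l a hc
    exact ⟨a, w, p, by rw [Walk.isPath_def, hp]; exact hn, by rw [hp]; exact ha⟩

theorem chain_lower {V : Type*} {R S : V → V → Prop} {x : V}
    (h : ∀ p q, R p q → p ≠ x → q ≠ x → S p q) :
    ∀ l : List V, x ∉ l → l.IsChain R → l.IsChain S := by
  intro l
  induction l with
  | nil => intro _ _; exact List.IsChain.nil
  | cons a l ih =>
    intro hx hc
    cases l with
    | nil => exact List.isChain_singleton a
    | cons b l =>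
      rw [List.isChain_cons_cons] at hc ⊢
      simp only [List.mem_cons, not_or] at hx
      refine ⟨h _ _ hc.1 (Ne.symm hx.1) (Ne.symm hx.2.1), ih ?_ hc.2⟩
      simp [hx.2.1, hx.2.2]

theorem start_case {V : Type*} (G : SimpleGraph V) (R : V → V → Prop) (v x y : V)
    (hnt : ¬ Traceable G) (hR : ∀ p q, R p q → G.Adj p q ∨ (p = x ∧ q = y) ∨ (p = y ∧ q = x))
    (hx : G.Adj v x) (hy : G.Adj v y) (hxy : x ≠ y) (b : List V)
    (hc : (v :: x :: b).IsChain R) (hn : (v :: x :: b).Nodup) (ha : ∀ z, z ∈ v :: x :: b) :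
    False := by
  have hvx := hx.ne
  have hvy := hy.ne
  have low := chain_lower (R := R) (S := G.Adj) (x := x)
    (by intro p q h h1 h2; rcases hR p q h with h | h | h <;> grind)
  cases b with
  | nil => have := ha y; grind
  | cons d b =>
    simp only [List.isChain_cons_cons] at hc
    have hd : (d :: b).IsChain G.Adj := low _ (by grind) hc.2.2
    by_cases hdy : d = y
    · subst hdy
      refine hnt (traceable_of_list G (x :: v :: d :: b) (by simp) ?_ (by grind)
        (by intro z; have := ha z; grind))
      simp only [List.isChain_cons_cons]
      exact ⟨hx.symm, hy, hd⟩
    · refine hnt (traceable_of_list G (v :: x :: d :: b) (by simp) ?_ hn ha)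
      simp only [List.isChain_cons_cons]
      refine ⟨hx, ?_, hd⟩
      rcases hR _ _ hc.2.1 with h | h | h
      · exact h
      · exact absurd h.2 hdy
      · exact absurd h.1 hxy

theorem mid_case {V : Type*} (G : SimpleGraph V) (R : V → V → Prop) (v x y : V)
    (hnt : ¬ Traceable G) (hR : ∀ p q, R p q → G.Adj p q ∨ (p = x ∧ q = y) ∨ (p = y ∧ q = x))
    (hx : G.Adj v x) (hy : G.Adj v y) (a b : List V)
    (hc : (a ++ x :: v :: y :: b).IsChain R) (hn : (a ++ x :: v :: y :: b).Nodup)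
    (ha : ∀ z, z ∈ a ++ x :: v :: y :: b) : False := by
  have low := chain_lower (R := R) (S := G.Adj) (x := x)
    (by intro p q h h1 h2; rcases hR p q h with h | h | h <;> grind)
  have low' := chain_lower (R := R) (S := G.Adj) (x := y)
    (by intro p q h h1 h2; rcases hR p q h with h | h | h <;> grind)
  rw [List.isChain_split] at hc
  have h1 := low' (a ++ [x]) (by grind) hc.1
  simp only [List.isChain_cons_cons] at hc
  have h2 := low (y :: b) (by grind) hc.2.2.2
  refine hnt (traceable_of_list G _ (by simp) ?_ hn ha)
  rw [List.isChain_split]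
  simp only [List.isChain_cons_cons]
  exact ⟨h1, hx.symm, hy, h2⟩

theorem stmt_19 {V : Type*} [Fintype V] [DecidableEq V] (G : SimpleGraph V)
    [DecidableRel G.Adj]
    (hnt : ¬ Traceable G)
    (hmax : ∀ u w : V, u ≠ w → ¬ G.Adj u w →
      Traceable (G ⊔ SimpleGraph.fromEdgeSet {s(u, w)}))
    (v x y : V) (hdeg : G.degree v = 2)
    (hx : G.Adj v x) (hy : G.Adj v y) (hxy : x ≠ y) :
    G.Adj x y := by
  by_contra hnadj
  have htr := hmax x y hxy hnadj
  generalize hH : G ⊔ SimpleGraph.fromEdgeSet {s(x, y)} = H at htr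
  obtain ⟨u, w, p, hp, hall⟩ := htr
  have hR : ∀ p q, H.Adj p q → G.Adj p q ∨ (p = x ∧ q = y) ∨ (p = y ∧ q = x) := by
    intro p q h
    simp only [← hH, SimpleGraph.sup_adj, SimpleGraph.fromEdgeSet_adj, Set.mem_singleton_iff,
      Sym2.eq_iff] at h
    tauto
  have hR' : ∀ p q, H.Adj p q → G.Adj p q ∨ (p = y ∧ q = x) ∨ (p = x ∧ q = y) := by
    intro p q h
    have := hR p q h
    tauto
  have hN : ∀ z, G.Adj v z → z = x ∨ z = y := by
    intro z hz
    have hs : ({x, y} : Finset V) = G.neighborFinset v := by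
      apply Finset.eq_of_subset_of_card_le
      · intro t ht
        simp only [Finset.mem_insert, Finset.mem_singleton] at ht
        rw [SimpleGraph.mem_neighborFinset]
        rcases ht with rfl | rfl <;> assumption
      · rw [SimpleGraph.card_neighborFinset_eq_degree, hdeg, Finset.card_pair hxy]
    have : z ∈ G.neighborFinset v := by rwa [SimpleGraph.mem_neighborFinset]
    rw [← hs] at this
    simpa using this
  have hvx := hx.ne
  have hvy := hy.ne
  have hN' : ∀ z, H.Adj v z → z = x ∨ z = y := by
    intro z hz
    rcases hR v z hz with h | h | h
    · exact hN z h
    · exact absurd h.1 hvx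
    · exact absurd h.1 hvy
  have hstart : ∀ b : List V, (v :: b).IsChain H.Adj → (v :: b).Nodup → (∀ z, z ∈ v :: b) →
      False := by
    intro b hc hn ha
    cases b with
    | nil => have := ha x; grind
    | cons c b =>
      have hvc := (List.isChain_cons_cons.1 hc).1
      rcases hN' c hvc with rfl | rfl
      · exact start_case G H.Adj v c y hnt hR hx hy hxy b hc hn ha
      · exact start_case G H.Adj v c x hnt hR' hy hx hxy.symm b hc hn ha
  have hc : p.support.IsChain H.Adj := p.isChain_adj_support
  have hn : p.support.Nodup := hp.support_nodup
  generalize p.support = l at hc hn hall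
  obtain ⟨a, b, rfl⟩ := List.append_of_mem (hall v)
  cases b with
  | nil =>
    refine hstart a.reverse ?_ ?_ ?_
    · have h2 : ((a ++ [v]).reverse).IsChain H.Adj := by
        rw [List.isChain_reverse]
        exact hc.imp fun _ _ h => h.symm
      simpa using h2
    · have := List.nodup_reverse.2 hn
      simpa using this
    · intro z; have := hall z; grind
  | cons c b =>
    rcases List.eq_nil_or_concat a with rfl | ⟨a, e, rfl⟩
    · exact hstart _ hc hn hall
    · simp only [List.concat_eq_append, List.append_assoc, List.singleton_append] at hc hn hall
      have h1 := hc
      rw [List.isChain_split] at h1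
      simp only [List.isChain_cons_cons] at h1
      have hec : e ≠ c := by grind
      rcases hN' e h1.2.1.symm with rfl | rfl <;> rcases hN' c h1.2.2.1 with rfl | rfl
      · exact hec rfl
      · exact mid_case G H.Adj v e c hnt hR hx hy a b hc hn hall
      · exact mid_case G H.Adj v e c hnt hR' hy hx a b hc hn hall
      · exact hec rfl
end
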